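/- arXiv:1509.06543 — 4 statements merged into one kernel-verified Lean document; each statement's English description precedes it below -/
import Mathlib

section
/- Suppose k = nr for a positive integer r, and identify ℂ^n ⊗ ℂ^k with ℂ^n ⊗ ℂ^n ⊗ ℂ^r. A unitary operator U on ℂ^n ⊗ ℂ^k has the property that for every density matrix β ∈ M_k^{1,+}(ℂ) the channel L_{U,β} is constant (L_{U,β}(ρ) = L_{U,β}(σ) for all density matrices ρ, σ ∈ M_n^{1,+}(ℂ)) if and only if there exist unitaries V, W on ℂ^k ≅ ℂ^n ⊗ ℂ^r such that U = (I_n ⊗ V)(F_n ⊗ I_r)(I_n ⊗ W), where F_n acts on the first two tensor factors ℂ^n ⊗ ℂ^n and V, W act on the last two tensor factors. -/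
open Matrix Kronecker ComplexOrder

noncomputable section

namespace BipartiteUnitary

/-- A square complex matrix is unitary. -/
def IsUnitary {m : Type*} [Fintype m] [DecidableEq m] (U : Matrix m m ℂ) : Prop :=
  U * Uᴴ = 1 ∧ Uᴴ * U = 1

/-- A density matrix: positive semidefinite with unit trace. -/
def IsDensity {m : Type*} [Fintype m] (β : Matrix m m ℂ) : Prop :=
  β.PosSemidef ∧ β.trace = 1

/-- Partial trace over the second tensor factor. -/
def trB {n k : Type*} [Fintype k] (M : Matrix (n × k) (n × k) ℂ) : Matrix n n ℂ :=
  fun i j => ∑ s, M (i, s) (j, s)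

/-- Partial trace over the first tensor factor. -/
def trA {n k : Type*} [Fintype n] (M : Matrix (n × k) (n × k) ℂ) : Matrix k k ℂ :=
  fun s t => ∑ i, M (i, s) (i, t)

/-- The quantum channel `L_{U,β}(X) = Tr_B (U (X ⊗ β) U*)`. -/
def channel {n k : Type*} [Fintype n] [Fintype k]
    (U : Matrix (n × k) (n × k) ℂ) (β : Matrix k k ℂ) (X : Matrix n n ℂ) :
    Matrix n n ℂ :=
  trB (U * (X ⊗ₖ β) * Uᴴ)

/-- The partial transpose `X^Γ = (id ⊗ t)(X)` with respect to the second factor. -/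
def pt {n k : Type*} (U : Matrix (n × k) (n × k) ℂ) : Matrix (n × k) (n × k) ℂ :=
  fun p q => U (p.1, q.2) (q.1, p.2)

/-- A family of vectors forming an orthonormal basis of `ℂ^k`. -/
def ONB {k : Type*} [Fintype k] [DecidableEq k] (e : k → k → ℂ) : Prop :=
  ∀ i j, (∑ s, star (e i s) * e j s) = if i = j then (1 : ℂ) else 0

/-- A partial isometry. -/
def IsPartialIso {m : Type*} [Fintype m] [DecidableEq m] (R : Matrix m m ℂ) : Prop :=
  R * Rᴴ * R = R

/-- Membership in `𝒰^A_{block-diag}`: `U = ∑ i, U_i ⊗ e_i f_i*` with `U_i` unitary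
and `{e_i}, {f_i}` orthonormal bases of `ℂ^k`. -/
def memUA {n k : ℕ} (U : Matrix (Fin n × Fin k) (Fin n × Fin k) ℂ) : Prop :=
  ∃ (Us : Fin k → Matrix (Fin n) (Fin n) ℂ) (e f : Fin k → Fin k → ℂ),
    (∀ i, IsUnitary (Us i)) ∧ ONB e ∧ ONB f ∧
    U = ∑ i, Us i ⊗ₖ vecMulVec (e i) (star (f i))

/-- Membership in `ℳ^A_{block-diag}`: `X = ∑ i, X_i ⊗ e_i f_i*` with arbitrary `X_i`. -/
def memMA {n k : ℕ} (X : Matrix (Fin n × Fin k) (Fin n × Fin k) ℂ) : Prop :=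
  ∃ (Xs : Fin k → Matrix (Fin n) (Fin n) ℂ) (e f : Fin k → Fin k → ℂ),
    ONB e ∧ ONB f ∧ X = ∑ i, Xs i ⊗ₖ vecMulVec (e i) (star (f i))

/-- Membership in `𝒰^B_{block-diag}`. -/
def memUB {n k : ℕ} (U : Matrix (Fin n × Fin k) (Fin n × Fin k) ℂ) : Prop :=
  ∃ (Us : Fin n → Matrix (Fin k) (Fin k) ℂ) (e f : Fin n → Fin n → ℂ),
    (∀ i, IsUnitary (Us i)) ∧ ONB e ∧ ONB f ∧
    U = ∑ i, vecMulVec (e i) (star (f i)) ⊗ₖ Us i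

/-- Membership in `ℳ^B_{block-diag}`. -/
def memMB {n k : ℕ} (X : Matrix (Fin n × Fin k) (Fin n × Fin k) ℂ) : Prop :=
  ∃ (Xs : Fin n → Matrix (Fin k) (Fin k) ℂ) (e f : Fin n → Fin n → ℂ),
    ONB e ∧ ONB f ∧ X = ∑ i, vecMulVec (e i) (star (f i)) ⊗ₖ Xs i

/-- The operator `F_n ⊗ I_r` on `ℂ^n ⊗ (ℂ^n ⊗ ℂ^r)`, where `F_n` flips the two
copies of `ℂ^n`. -/
def flipTensorId (n r : ℕ) :
    Matrix (Fin n × (Fin n × Fin r)) (Fin n × (Fin n × Fin r)) ℂ :=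
  fun p q => if p.1 = q.2.1 ∧ p.2.1 = q.1 ∧ p.2.2 = q.2.2 then 1 else 0

/-- The `(i, j)` block of a bipartite matrix. -/
def blk {n k : Type*} (U : Matrix (n × k) (n × k) ℂ) (i j : n) : Matrix k k ℂ :=
  fun s t => U (i, s) (j, t)

section helpers
set_option linter.unusedSectionVars false
variable {n k : Type*} [Fintype n] [Fintype k] [DecidableEq n] [DecidableEq k]

theorem blk_ext {A B : Matrix (n × k) (n × k) ℂ} (h : ∀ i j, blk A i j = blk B i j) : A = B := by
  ext ⟨i, s⟩ ⟨j, t⟩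
  exact congrFun (congrFun (h i j) s) t

theorem blk_mul (A B : Matrix (n × k) (n × k) ℂ) (i j : n) :
    blk (A * B) i j = ∑ l, blk A i l * blk B l j := by
  ext s t
  simp [blk, Matrix.mul_apply, Matrix.sum_apply, Fintype.sum_prod_type]

theorem blk_conj (A : Matrix (n × k) (n × k) ℂ) (i j : n) :
    blk Aᴴ i j = (blk A j i)ᴴ := by
  ext s t
  simp [blk]

theorem blk_one (i j : n) :
    blk (1 : Matrix (n × k) (n × k) ℂ) i j = if i = j then 1 else 0 := by
  ext s t
  by_cases h : i = j <;> simp [blk, Matrix.one_apply, h]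

theorem blk_kron (X : Matrix n n ℂ) (β : Matrix k k ℂ) (i j : n) :
    blk (X ⊗ₖ β) i j = X i j • β := by
  ext s t
  simp [blk]

theorem channel_apply (U : Matrix (n × k) (n × k) ℂ) (β : Matrix k k ℂ) (X : Matrix n n ℂ)
    (i i' : n) : channel U β X i i' =
      ∑ j', ∑ j, X j j' * ((blk U i' j')ᴴ * blk U i j * β).trace := by
  have h : channel U β X i i' = (blk (U * (X ⊗ₖ β) * Uᴴ) i i').trace := rfl
  rw [h, blk_mul]
  simp only [blk_mul, blk_conj, blk_kron, Matrix.trace_sum, Matrix.sum_mul]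
  refine Finset.sum_congr rfl fun j' _ => Finset.sum_congr rfl fun j _ => ?_
  rw [Matrix.mul_smul, Matrix.smul_mul, Matrix.trace_smul, smul_eq_mul, Matrix.mul_assoc,
    Matrix.trace_mul_comm, Matrix.mul_assoc, Matrix.trace_mul_comm, Matrix.mul_assoc]

section span
open scoped Matrix.Norms.L2Operator MatrixOrder
theorem span_psd : Submodule.span ℂ {A : Matrix n n ℂ | A.PosSemidef} = ⊤ := by
  have := CStarAlgebra.span_nonneg (A := Matrix n n ℂ)
  rw [← this]
  congr 1
  ext A
  simp [Matrix.nonneg_iff_posSemidef]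
end span

theorem lin_const (f : Matrix n n ℂ →ₗ[ℂ] ℂ) (c : ℂ) (h : ∀ ρ, IsDensity ρ → f ρ = c)
    (X : Matrix n n ℂ) : f X = c * X.trace := by
  have hX : X ∈ Submodule.span ℂ {A : Matrix n n ℂ | A.PosSemidef} := by
    rw [span_psd]; trivial
  induction hX using Submodule.span_induction with
  | mem A hA =>
    have hA : A.PosSemidef := hA
    by_cases h0 : A.trace = 0
    · rw [hA.trace_eq_zero_iff.mp h0]; simp
    · have := h (A.trace⁻¹ • A) ⟨hA.smul (by
        exact inv_nonneg.mpr hA.trace_nonneg), by simp [Matrix.trace_smul, h0]⟩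
      rw [map_smul, smul_eq_mul] at this
      field_simp at this
      rw [this]; ring
  | zero => simp
  | add A B _ _ ha hb => rw [map_add, ha, hb, Matrix.trace_add]; ring
  | smul a A _ ha => rw [map_smul, ha, Matrix.trace_smul, smul_eq_mul, smul_eq_mul]; ring

theorem trace_zero (M : Matrix k k ℂ) (h : ∀ β, IsDensity β → (M * β).trace = 0) : M = 0 := by
  apply Matrix.ext_iff_trace_mul_right.mpr
  intro X
  have := lin_const ((Matrix.traceLinearMap k ℂ ℂ).comp (LinearMap.mulLeft ℂ M)) 0
    (by intro ρ hρ; simpa using h ρ hρ) X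
  simpa using this

theorem exists_density (i : n) : IsDensity (Matrix.single i i (1:ℂ)) := by
  refine ⟨?_, by simp⟩
  rw [← Matrix.diagonal_single]
  apply Matrix.PosSemidef.diagonal
  intro j
  by_cases h : j = i
  · subst h; simp
  · simp [h]

theorem const_blocks (U : Matrix (n × k) (n × k) ℂ) (z : n)
    (h : ∀ β : Matrix k k ℂ, IsDensity β →
      ∀ ρ σ : Matrix n n ℂ, IsDensity ρ → IsDensity σ →
        channel U β ρ = channel U β σ) (i i' j j' : n) :
    (blk U i' j')ᴴ * blk U i j = if j = j' then (blk U i' z)ᴴ * blk U i z else 0 := by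
  have key : ∀ β : Matrix k k ℂ, IsDensity β → ∃ c : ℂ, ∀ j j',
      ((blk U i' j')ᴴ * blk U i j * β).trace = if j = j' then c else 0 := by
    intro β hβ
    refine ⟨channel U β (Matrix.single z z 1) i i', fun j j' => ?_⟩
    let f : Matrix n n ℂ →ₗ[ℂ] ℂ :=
      { toFun := fun X => channel U β X i i'
        map_add' := by
          intro X Y
          simp only [channel_apply, Matrix.add_apply, add_mul, Finset.sum_add_distrib]
        map_smul' := by
          intro a X
          simp only [channel_apply, Matrix.smul_apply, smul_eq_mul, mul_assoc, Finset.mul_sum,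
            RingHom.id_apply] }
    have h1 := lin_const f (channel U β (Matrix.single z z 1) i i') (fun ρ hρ =>
      congrFun (congrFun (h β hβ _ _ hρ (exists_density z)) i) i') (Matrix.single j j' 1)
    have h2 : f (Matrix.single j j' 1) = ((blk U i' j')ᴴ * blk U i j * β).trace := by
      change channel U β _ i i' = _
      rw [channel_apply, Finset.sum_eq_single j', Finset.sum_eq_single j]
      · simp
      · intro b _ hb; simp [Matrix.single, hb.symm]
      · simp
      · intro b _ hb; simp [Matrix.single, hb.symm]
      · simp
    rw [h2] at h1
    rw [h1]
    by_cases hj : j = j'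
    · subst hj; simp
    · simp [hj, Matrix.trace_single_eq_of_ne]
  split_ifs with hj
  · subst hj
    rw [← sub_eq_zero]
    apply trace_zero
    intro β hβ
    obtain ⟨c, hc⟩ := key β hβ
    rw [Matrix.sub_mul, Matrix.trace_sub, hc, hc]
    simp
  · apply trace_zero
    intro β hβ
    obtain ⟨c, hc⟩ := key β hβ
    rw [hc, if_neg hj]

/-- Factor a Hermitian projection of trace `r` through `ℂ^r`. -/
theorem proj_factor (P : Matrix k k ℂ) (hP : Pᴴ = P) (hPP : P * P = P) (r : ℕ)
    (ht : P.trace = r) : ∃ Q : Matrix (Fin r) k ℂ, Qᴴ * Q = P ∧ Q * Qᴴ = 1 := by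
  have hH : P.IsHermitian := hP
  set u : Matrix k k ℂ := (hH.eigenvectorUnitary : Matrix k k ℂ) with hu
  have hu1 : uᴴ * u = 1 := by
    have := Unitary.coe_star_mul_self hH.eigenvectorUnitary
    simpa [Matrix.star_eq_conjTranspose] using this
  have hu2 : u * uᴴ = 1 := mul_eq_one_comm.mp hu1
  set d : k → ℂ := fun i => (hH.eigenvalues i : ℂ) with hd
  have hs : P = u * Matrix.diagonal d * uᴴ := by
    have := hH.spectral_theorem
    rw [Unitary.conjStarAlgAut_apply] at this
    exact this
  have hdd : ∀ i, d i * d i = d i := by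
    have h1 : Matrix.diagonal d = uᴴ * P * u := by
      rw [hs]
      simp only [Matrix.mul_assoc, hu1, Matrix.mul_one]
      rw [← Matrix.mul_assoc, hu1, Matrix.one_mul]
    have h2 : Matrix.diagonal d * Matrix.diagonal d = Matrix.diagonal d := by
      rw [h1]
      calc uᴴ * P * u * (uᴴ * P * u) = uᴴ * P * (u * uᴴ) * P * u := by
            simp only [Matrix.mul_assoc]
        _ = uᴴ * (P * P) * u := by rw [hu2]; simp only [Matrix.mul_assoc, Matrix.one_mul]
        _ = _ := by rw [hPP]
    intro i
    have := congrFun (congrFun h2 i) i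
    simpa using this
  have hd01 : ∀ i, d i = if d i = 1 then 1 else 0 := by
    intro i
    split_ifs with h
    · exact h
    · have := hdd i
      have h3 : d i * (d i - 1) = 0 := by rw [mul_sub, this]; ring
      rcases mul_eq_zero.mp h3 with h4 | h4
      · exact h4
      · exact absurd (sub_eq_zero.mp h4) h
  have hcard : Fintype.card {i // d i = 1} = r := by
    have h1 : P.trace = ∑ i, d i := by
      rw [hs, Matrix.trace_mul_comm, ← Matrix.mul_assoc, hu1, Matrix.one_mul,
        Matrix.trace_diagonal]
    rw [ht] at h1
    rw [Finset.sum_congr rfl (fun i _ => hd01 i), Finset.sum_boole] at h1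
    rw [Fintype.card_subtype]
    exact_mod_cast h1.symm
  let e : Fin r ≃ {i // d i = 1} := (Fintype.equivFinOfCardEq hcard).symm
  refine ⟨Matrix.of fun a s => star (u s (e a)), ?_, ?_⟩
  · ext s t
    rw [hs, Matrix.mul_apply, Matrix.mul_apply]
    simp only [Matrix.of_apply, Matrix.mul_diagonal, Matrix.conjTranspose_apply, star_star]
    rw [Equiv.sum_comp e (fun x => u s x * star (u t x))]
    have : ∀ x, u s x * d x * star (u t x) = if d x = 1 then u s x * star (u t x) else 0 := by
      intro x
      rw [hd01 x]
      by_cases hx : d x = 1 <;> simp [hx]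
    simp only [this]
    rw [← Finset.sum_filter]
    exact (Finset.sum_subtype _ (by simp) (fun x => u s x * star (u t x))).symm
  · ext a b
    have := congrFun (congrFun hu1 (e a)) (e b)
    rw [Matrix.mul_apply] at this
    rw [Matrix.mul_apply]
    simp only [Matrix.of_apply, Matrix.conjTranspose_apply, star_star] at this ⊢
    rw [this, Matrix.one_apply, Matrix.one_apply]
    simp [Subtype.ext_iff.symm]

end helpers

/-- Block column. -/
def colB {n r : ℕ} {m : Type*} (V : Matrix m (Fin n × Fin r) ℂ) (j : Fin n) :
    Matrix m (Fin r) ℂ := fun s a => V s (j, a)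

theorem blk_form (n r : ℕ) (V W : Matrix (Fin n × Fin r) (Fin n × Fin r) ℂ) (i j : Fin n) :
    blk (((1 : Matrix (Fin n) (Fin n) ℂ) ⊗ₖ V) * flipTensorId n r *
            ((1 : Matrix (Fin n) (Fin n) ℂ) ⊗ₖ W)) i j = colB V j * (colB Wᴴ i)ᴴ := by
  rw [blk_mul]
  simp only [blk_mul, blk_kron, Matrix.one_apply]
  simp only [ite_smul, one_smul, zero_smul, ite_mul, mul_ite, Matrix.zero_mul, Matrix.mul_zero,
    Finset.sum_ite_eq, Finset.sum_ite_eq', Finset.mem_univ, if_true]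
  have : blk (flipTensorId n r) i j =
      colB (1 : Matrix (Fin n × Fin r) (Fin n × Fin r) ℂ) j *
        (colB (1 : Matrix (Fin n × Fin r) (Fin n × Fin r) ℂ) i)ᴴ := by
    ext ⟨a, x⟩ ⟨b, y⟩
    simp only [blk, flipTensorId, colB, Matrix.mul_apply, Matrix.conjTranspose_apply,
      Matrix.one_apply, Prod.mk.injEq]
    by_cases h1 : i = b <;> by_cases h2 : a = j <;> by_cases h3 : x = y <;>
      simp [h1, h2, h3, eq_comm]
  rw [this]
  have hV : colB V j = V * colB (1 : Matrix (Fin n × Fin r) (Fin n × Fin r) ℂ) j := by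
    ext s a; simp [colB, Matrix.mul_apply, Matrix.one_apply]
  have hW : colB Wᴴ i = Wᴴ * colB (1 : Matrix (Fin n × Fin r) (Fin n × Fin r) ℂ) i := by
    ext s a; simp [colB, Matrix.mul_apply, Matrix.one_apply]
  rw [hV, hW, Matrix.conjTranspose_mul, Matrix.conjTranspose_conjTranspose]
  simp only [Matrix.mul_assoc]

theorem col_unitary {n r : ℕ} (V : Matrix (Fin n × Fin r) (Fin n × Fin r) ℂ) :
    IsUnitary V ↔ ∀ i j, (colB V i)ᴴ * colB V j = if i = j then 1 else 0 := by
  constructor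
  · rintro ⟨-, h⟩ i j
    ext a b
    have := congrFun (congrFun h (i, a)) (j, b)
    rw [Matrix.mul_apply] at this
    rw [Matrix.mul_apply]
    refine Eq.trans this ?_
    by_cases hij : i = j <;> simp [hij, Matrix.one_apply]
  · intro h
    have h2 : Vᴴ * V = 1 := by
      ext ⟨i, a⟩ ⟨j, b⟩
      have := congrFun (congrFun (h i j) a) b
      rw [Matrix.mul_apply] at this
      rw [Matrix.mul_apply]
      refine Eq.trans this ?_
      by_cases hij : i = j <;> simp [hij, Matrix.one_apply]
    exact ⟨mul_eq_one_comm.mp h2, h2⟩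

theorem forward (n r : ℕ) (hn : 0 < n)
    (U : Matrix (Fin n × (Fin n × Fin r)) (Fin n × (Fin n × Fin r)) ℂ)
    (hU : IsUnitary U)
    (h : ∀ β : Matrix (Fin n × Fin r) (Fin n × Fin r) ℂ, IsDensity β →
      ∀ ρ σ : Matrix (Fin n) (Fin n) ℂ, IsDensity ρ → IsDensity σ →
        channel U β ρ = channel U β σ) :
    ∃ V W : Matrix (Fin n × Fin r) (Fin n × Fin r) ℂ, IsUnitary V ∧ IsUnitary W ∧
        U = ((1 : Matrix (Fin n) (Fin n) ℂ) ⊗ₖ V) * flipTensorId n r *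
            ((1 : Matrix (Fin n) (Fin n) ℂ) ⊗ₖ W) := by
  let z : Fin n := ⟨0, hn⟩
  have hB := const_blocks U z h
  set B := blk U with hBdef
  set C : Fin n → Fin n → Matrix (Fin n × Fin r) (Fin n × Fin r) ℂ :=
    fun i i' => (B i z)ᴴ * B i' z with hC
  have hB' : ∀ i i' j j', (B i' j')ᴴ * B i j = if j = j' then C i' i else 0 := hB
  have hrow : ∀ i i', ∑ l, B i l * (B i' l)ᴴ = if i = i' then 1 else 0 := by
    intro i i'
    have := blk_mul U Uᴴ i i'
    rw [hU.1, blk_one] at this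
    simp only [blk_conj] at this
    exact this.symm
  have hcol : ∑ l, C l l = 1 := by
    have := blk_mul Uᴴ U z z
    rw [hU.2, blk_one] at this
    simp only [blk_conj, if_true] at this
    exact this.symm
  -- the key absorption identity
  have habs : ∀ i i' k j, B i j * (B i' j)ᴴ * B k j = if i = i' then B k j else 0 := by
    intro i i' k j
    have h1 : (∑ l, B i l * (B i' l)ᴴ) * B k j = B i j * (B i' j)ᴴ * B k j := by
      rw [Matrix.sum_mul, Finset.sum_eq_single j]
      · intro b _ hb
        rw [Matrix.mul_assoc, hB', if_neg hb.symm, Matrix.mul_zero]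
      · simp
    rw [← h1, hrow]
    split_ifs <;> simp
  have hCC : ∀ i i' k k', C i i' * C k k' = if i' = k then C i k' else 0 := by
    intro i i' k k'
    have : C i i' * C k k' = (B i z)ᴴ * (B i' z * (B k z)ᴴ * B k' z) := by
      simp only [hC, Matrix.mul_assoc]
    rw [this, habs]
    split_ifs <;> simp [hC]
  have hCs : ∀ i i', (C i i')ᴴ = C i' i := by
    intro i i'
    simp [hC, Matrix.conjTranspose_mul]
  have htr : (C z z).trace = r := by
    have h1 : ∀ l, (C l l).trace = (C z z).trace := by
      intro l
      have e1 : C l l = C l z * C z l := by rw [hCC, if_pos rfl]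
      have e2 : C z z = C z l * C l z := by rw [hCC, if_pos rfl]
      rw [e1, e2, Matrix.trace_mul_comm]
    have h2 := congrArg Matrix.trace hcol
    rw [Matrix.trace_sum, Finset.sum_congr rfl (fun l _ => h1 l)] at h2
    simp at h2
    have : (n : ℂ) ≠ 0 := by exact_mod_cast hn.ne'
    exact h2.resolve_right (by omega)
  obtain ⟨Q, hQ1, hQ2⟩ := proj_factor (C z z) (hCs z z) (by rw [hCC, if_pos rfl]) r htr
  have hQC : Q * C z z * Qᴴ = 1 := by
    rw [← hQ1, ← Matrix.mul_assoc, hQ2, Matrix.one_mul, hQ2]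
  let V : Matrix (Fin n × Fin r) (Fin n × Fin r) ℂ := fun s p => (B z p.1 * Qᴴ) s p.2
  let W' : Matrix (Fin n × Fin r) (Fin n × Fin r) ℂ := fun s p => (C p.1 z * Qᴴ) s p.2
  have hV : ∀ j, colB V j = B z j * Qᴴ := fun j => rfl
  have hW : ∀ j, colB W' j = C j z * Qᴴ := fun j => rfl
  refine ⟨V, W'ᴴ, ?_, ?_, ?_⟩
  · rw [col_unitary]
    intro i j
    rw [hV, hV, Matrix.conjTranspose_mul, Matrix.conjTranspose_conjTranspose]
    have : Q * (B z i)ᴴ * (B z j * Qᴴ) = Q * ((B z i)ᴴ * B z j) * Qᴴ := by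
      simp only [Matrix.mul_assoc]
    rw [this, hB']
    by_cases hij : i = j
    · simp [hij, hQC]
    · simp [hij, Ne.symm hij]
  · have : IsUnitary W' := by
      rw [col_unitary]
      intro i j
      rw [hW, hW, Matrix.conjTranspose_mul, Matrix.conjTranspose_conjTranspose, hCs]
      have : Q * C z i * (C j z * Qᴴ) = Q * (C z i * C j z) * Qᴴ := by
        simp only [Matrix.mul_assoc]
      rw [this, hCC]
      by_cases hij : i = j
      · simp [hij, hQC]
      · simp [hij]
    exact ⟨by simpa using this.2, by simpa using this.1⟩
  · apply blk_ext
    intro i j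
    rw [blk_form, Matrix.conjTranspose_conjTranspose, hV, hW, Matrix.conjTranspose_mul,
      Matrix.conjTranspose_conjTranspose, hCs]
    have : B z j * Qᴴ * (Q * C z i) = B z j * ((Qᴴ * Q) * C z i) := by
      simp only [Matrix.mul_assoc]
    rw [this, hQ1, hCC, if_pos rfl]
    have h3 : C z i = (B z j)ᴴ * B i j := by rw [hB', if_pos rfl]
    rw [h3, ← Matrix.mul_assoc, habs, if_pos rfl]

theorem backward (n r : ℕ) (V W : Matrix (Fin n × Fin r) (Fin n × Fin r) ℂ) (hV : IsUnitary V)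
    (β : Matrix (Fin n × Fin r) (Fin n × Fin r) ℂ) (ρ : Matrix (Fin n) (Fin n) ℂ)
    (hρ : IsDensity ρ) (i i' : Fin n) :
    channel (((1 : Matrix (Fin n) (Fin n) ℂ) ⊗ₖ V) * flipTensorId n r *
            ((1 : Matrix (Fin n) (Fin n) ℂ) ⊗ₖ W)) β ρ i i' =
      (colB Wᴴ i' * (colB Wᴴ i)ᴴ * β).trace := by
  rw [channel_apply]
  rw [col_unitary] at hV
  have : ∀ j j', (colB V j' * (colB Wᴴ i')ᴴ)ᴴ * (colB V j * (colB Wᴴ i)ᴴ) =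
      if j' = j then colB Wᴴ i' * (colB Wᴴ i)ᴴ else 0 := by
    intro j j'
    rw [Matrix.conjTranspose_mul, Matrix.conjTranspose_conjTranspose, Matrix.mul_assoc,
      ← Matrix.mul_assoc (colB V j')ᴴ, hV]
    split_ifs <;> simp
  simp only [blk_form, this]
  have h2 : ∀ j j', ρ j j' * ((if j' = j then colB Wᴴ i' * (colB Wᴴ i)ᴴ else 0) * β).trace =
      if j' = j then ρ j j' * (colB Wᴴ i' * (colB Wᴴ i)ᴴ * β).trace else 0 := by
    intro j j'
    split_ifs <;> simp
  simp only [h2, Finset.sum_ite_eq, Finset.mem_univ, if_true]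
  rw [← Finset.sum_mul]
  have : ∑ j, ρ j j = 1 := hρ.2
  rw [this, one_mul]

/-- when `k = n·r`, a bipartite unitary yields constant channels for
all ancilla states iff it has the form `(I_n ⊗ V)(F_n ⊗ I_r)(I_n ⊗ W)`. -/
theorem stmt5 (n r : ℕ) (hn : 0 < n) (hr : 0 < r)
    (U : Matrix (Fin n × (Fin n × Fin r)) (Fin n × (Fin n × Fin r)) ℂ)
    (hU : IsUnitary U) :
    (∀ β : Matrix (Fin n × Fin r) (Fin n × Fin r) ℂ, IsDensity β →
      ∀ ρ σ : Matrix (Fin n) (Fin n) ℂ, IsDensity ρ → IsDensity σ →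
        channel U β ρ = channel U β σ)
    ↔ ∃ V W : Matrix (Fin n × Fin r) (Fin n × Fin r) ℂ, IsUnitary V ∧ IsUnitary W ∧
        U = ((1 : Matrix (Fin n) (Fin n) ℂ) ⊗ₖ V) * flipTensorId n r *
            ((1 : Matrix (Fin n) (Fin n) ℂ) ⊗ₖ W) := by
  constructor
  · exact forward n r hn U hU
  · rintro ⟨V, W, hV, -, rfl⟩ β _ ρ σ hρ hσ
    ext i i'
    rw [backward n r V W hV β ρ hρ, backward n r V W hV β σ hσ]

end BipartiteUnitary
end
end

section
/- Let n = 2 and k ≥ 2. For a unitary operator U on ℂ² ⊗ ℂ^k, the following are equivalent: (1) for every density matrix β ∈ M_k^{1,+}(ℂ), the channel L_{U,β} is mixed unitary, i.e. a convex combination L_{U,β}(X) = Σ_i p_i(β) U_i(β) X U_i(β)* with p_i(β) ≥ 0, Σ_i p_i(β) = 1 and U_i(β) unitary on ℂ²; (2) L_{U,β}(I_2) = I_2 for every density matrix β ∈ M_k^{1,+}(ℂ); (3) the partial transpose U^Γ = (id ⊗ t)(U) is unitary. In other words, for n = 2, U_mixed = U_unital. -/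
open Matrix Kronecker ComplexOrder

noncomputable section

namespace BipartiteUnitary

/-- A mixed unitary channel: a convex combination of unitary conjugations. -/
def IsMixedUnitary {n : ℕ}
    (L : Matrix (Fin n) (Fin n) ℂ → Matrix (Fin n) (Fin n) ℂ) : Prop :=
  ∃ (r : ℕ) (p : Fin r → ℝ) (Us : Fin r → Matrix (Fin n) (Fin n) ℂ),
    (∀ i, 0 ≤ p i) ∧ (∑ i, p i) = 1 ∧ (∀ i, IsUnitary (Us i)) ∧
    ∀ X : Matrix (Fin n) (Fin n) ℂ, L X = ∑ i, (p i : ℂ) • (Us i * X * (Us i)ᴴ)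

/-- The quaternion basis `1, iX, iY, iZ`, reshaped as a matrix. -/
def magic : Matrix (Fin 2 × Fin 2) (Fin 4) ℂ := fun p c =>
  (![!![1, 0; 0, 1], !![0, Complex.I; Complex.I, 0], !![0, 1; -1, 0],
    !![Complex.I, 0; 0, -Complex.I]] c : Matrix (Fin 2) (Fin 2) ℂ) p.1 p.2

lemma magic_mul : magic * magicᴴ = (2 : ℂ) • 1 := by
  ext ⟨i, a⟩ ⟨j, b⟩
  fin_cases i <;> fin_cases a <;> fin_cases j <;> fin_cases b <;>
    simp [magic, Matrix.mul_apply, Fin.sum_univ_four] <;> norm_num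

lemma real_spectral (R : Matrix (Fin 4) (Fin 4) ℝ) (hR : R.PosSemidef) :
    ∃ (p : Fin 4 → ℝ) (v : Fin 4 → Fin 4 → ℝ), (∀ m, 0 ≤ p m) ∧ (∑ m, p m = R.trace) ∧
      (∀ m, ∑ c, v m c * v m c = 1) ∧ ∀ c d, R c d = ∑ m, p m * (v m c * v m d) := by
  have hH := hR.isHermitian
  refine ⟨hH.eigenvalues, fun m c => (hH.eigenvectorUnitary : Matrix (Fin 4) (Fin 4) ℝ) c m,
    fun m => hR.eigenvalues_nonneg m, ?_, ?_, ?_⟩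
  · rw [hH.trace_eq_sum_eigenvalues]; simp
  · intro m
    have h := Unitary.coe_star_mul_self hH.eigenvectorUnitary
    have := congrFun (congrFun h m) m
    simpa [Matrix.mul_apply, Matrix.star_apply] using this
  · intro c d
    have h := hH.spectral_theorem
    have := congrFun (congrFun h c) d
    rw [this]
    simp [Unitary.conjStarAlgAut_apply, Matrix.mul_apply, Matrix.star_apply, Matrix.diagonal_apply]
    refine Finset.sum_congr rfl fun m _ => by ring

lemma magic_unitary (v : Fin 4 → ℝ) (hv : ∑ c, v c * v c = 1) :
    IsUnitary (fun i a => ∑ c, magic (i, a) c * (v c : ℂ) : Matrix (Fin 2) (Fin 2) ℂ) := by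
  have h : (v 0 : ℂ) * v 0 + v 1 * v 1 + v 2 * v 2 + v 3 * v 3 = 1 := by
    rw [Fin.sum_univ_four] at hv
    exact_mod_cast hv
  have hI := Complex.I_mul_I
  have hM : (fun i a => ∑ c, magic (i, a) c * (v c : ℂ) : Matrix (Fin 2) (Fin 2) ℂ) =
      !![v 0 + Complex.I * v 3, Complex.I * v 1 + v 2; Complex.I * v 1 - v 2,
        v 0 - Complex.I * v 3] := by
    ext i j
    fin_cases i <;> fin_cases j <;> simp [magic, Fin.sum_univ_four] <;> ring
  rw [hM]
  constructor
  · ext i j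
    fin_cases i <;> fin_cases j <;>
    simp [Matrix.mul_apply, Fin.sum_univ_two] <;>
    grind
  · ext i j
    fin_cases i <;> fin_cases j <;>
    simp [Matrix.mul_apply, Fin.sum_univ_two] <;>
    grind

lemma qubit (C : Matrix (Fin 2 × Fin 2) (Fin 2 × Fin 2) ℂ) (hC : C.PosSemidef)
    (h1 : ∀ a b, ∑ i, C (i, a) (i, b) = if a = b then 1 else 0)
    (h2 : ∀ i j, ∑ a, C (i, a) (j, a) = if i = j then 1 else 0) :
    ∃ (p : Fin 4 → ℝ) (Us : Fin 4 → Matrix (Fin 2) (Fin 2) ℂ),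
      (∀ m, 0 ≤ p m) ∧ (∑ m, p m = 1) ∧ (∀ m, IsUnitary (Us m)) ∧
      ∀ i a j b, C (i, a) (j, b) = ∑ m, (p m : ℂ) * (Us m i a * star (Us m j b)) := by
  obtain ⟨R, hRdef⟩ : ∃ R : Matrix (Fin 4) (Fin 4) ℂ,
      R = ((1/2 : ℂ) • magicᴴ) * C * ((1/2 : ℂ) • magicᴴ)ᴴ := ⟨_, rfl⟩
  have hR : R.PosSemidef := hRdef ▸ hC.mul_mul_conjTranspose_same _
  have hCR : C = magic * R * magicᴴ := by
    have : magic * R * magicᴴ = (1/4 : ℂ) • ((magic * magicᴴ) * C * (magic * magicᴴ)) := by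
      rw [hRdef]
      simp only [conjTranspose_smul, conjTranspose_conjTranspose, Matrix.smul_mul, Matrix.mul_smul,
        smul_smul, Matrix.mul_assoc]
      congr 1
      norm_num
    rw [this, magic_mul]
    simp [smul_smul]
    norm_num
  have e1 := h1 0 0
  have e2 := h1 0 1
  have e3 := h1 1 0
  have e4 := h1 1 1
  have f1 := h2 0 0
  have f2 := h2 0 1
  have f3 := h2 1 0
  have f4 := h2 1 1
  simp [Fin.sum_univ_two] at e1 e2 e3 e4 f1 f2 f3 f4
  have hI := Complex.I_mul_I
  have hsymm : ∀ c d, R c d = R d c := by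
    have key : R 0 1 = R 1 0 ∧ R 0 2 = R 2 0 ∧ R 0 3 = R 3 0 ∧ R 1 2 = R 2 1 ∧
        R 1 3 = R 3 1 ∧ R 2 3 = R 3 2 := by
      simp only [hRdef]
      refine ⟨?_, ?_, ?_, ?_, ?_, ?_⟩ <;>
      simp [magic, Matrix.mul_apply, Fin.sum_univ_four, Fintype.sum_prod_type] <;>
      grind
    obtain ⟨k1, k2, k3, k4, k5, k6⟩ := key
    clear hRdef hCR hR e1 e2 e3 e4 f1 f2 f3 f4 hI
    intro c d
    fin_cases c <;> fin_cases d <;>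
      first
      | rfl
      | exact k1
      | exact k2
      | exact k3
      | exact k4
      | exact k5
      | exact k6
      | exact k1.symm
      | exact k2.symm
      | exact k3.symm
      | exact k4.symm
      | exact k5.symm
      | exact k6.symm
  have htr : R.trace = 1 := by
    simp only [hRdef]
    simp [magic, Matrix.trace, Matrix.mul_apply, Fin.sum_univ_four, Fintype.sum_prod_type]
    grind
  have hreal : ∀ c d, (((R c d).re : ℝ) : ℂ) = R c d := by
    intro c d
    have := hR.isHermitian.apply c d
    rw [hsymm d c] at this
    exact Complex.conj_eq_iff_re.mp this
  have hRr : (R.map Complex.re).PosSemidef := by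
    refine Matrix.PosSemidef.of_dotProduct_mulVec_nonneg ?_ ?_
    · ext c d
      simp [hsymm d c]
    · intro x
      have := hR.dotProduct_mulVec_nonneg (fun c => (x c : ℂ))
      have := (Complex.le_def.mp this).1
      simpa [dotProduct, Matrix.mulVec] using this
  obtain ⟨p, v, hp, hps, hv, hsp⟩ := real_spectral _ hRr
  refine ⟨p, fun m i a => ∑ c, magic (i, a) c * (v m c : ℂ), hp, ?_, fun m => magic_unitary _ (hv m), ?_⟩
  · rw [hps]
    have := congrArg Complex.re htr
    simpa [Matrix.trace] using this
  · intro i a j b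
    have hR2 : ∀ c d, R c d = ∑ m, (p m : ℂ) * ((v m c : ℂ) * v m d) := by
      intro c d
      rw [← hreal]
      have := hsp c d
      simp only [Matrix.map_apply] at this
      rw [this]
      push_cast
      rfl
    conv_lhs => rw [hCR]
    simp only [Matrix.mul_apply, hR2, star_sum, star_mul', Matrix.conjTranspose_apply]
    simp only [Finset.sum_mul, Finset.mul_sum, Complex.star_def, Complex.conj_ofReal]
    conv_lhs =>
      rw [Finset.sum_comm]
      enter [2, c]
      rw [Finset.sum_comm]
    rw [Finset.sum_comm]
    refine Finset.sum_congr rfl fun m _ => ?_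
    rw [Finset.sum_comm]
    refine Finset.sum_congr rfl fun m _ => ?_
    refine Finset.sum_congr rfl fun m _ => ?_
    ring

/-- The Choi-type matrix of the channel. -/
def choi {k : ℕ} (U : Matrix (Fin 2 × Fin k) (Fin 2 × Fin k) ℂ) (β : Matrix (Fin k) (Fin k) ℂ) :
    Matrix (Fin 2 × Fin 2) (Fin 2 × Fin 2) ℂ :=
  fun p q => ∑ s, ∑ t, ∑ t', U (p.1, s) (p.2, t) * β t t' * star (U (q.1, s) (q.2, t'))

lemma channel_choi {k : ℕ} (U : Matrix (Fin 2 × Fin k) (Fin 2 × Fin k) ℂ)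
    (β : Matrix (Fin k) (Fin k) ℂ) (X : Matrix (Fin 2) (Fin 2) ℂ) (i j : Fin 2) :
    channel U β X i j = ∑ a, ∑ b, X a b * choi U β (i, a) (j, b) := by
  simp only [channel, trB, choi, Matrix.mul_apply, Fintype.sum_prod_type, kroneckerMap_apply,
    Matrix.conjTranspose_apply, Finset.sum_mul, Finset.mul_sum, Fin.sum_univ_two,
    ← Finset.sum_add_distrib]
  refine Finset.sum_congr rfl fun s _ => ?_
  rw [Finset.sum_comm]
  refine Finset.sum_congr rfl fun t _ => Finset.sum_congr rfl fun t' _ => ?_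
  ring

lemma choi_posSemidef {k : ℕ} (U : Matrix (Fin 2 × Fin k) (Fin 2 × Fin k) ℂ)
    (β : Matrix (Fin k) (Fin k) ℂ) (hβ : β.PosSemidef) : (choi U β).PosSemidef := by
  obtain ⟨S, hS⟩ : ∃ S : Matrix (Fin k) (Fin k) ℂ, β = Sᴴ * S := by
    open scoped MatrixOrder in
    exact CStarAlgebra.nonneg_iff_eq_star_mul_self.mp hβ.nonneg
  obtain ⟨G, hG⟩ : ∃ G : Matrix (Fin 2 × Fin 2) (Fin k × Fin k) ℂ,
      ∀ p st, G p st = ∑ t, U (p.1, st.1) (p.2, t) * star (S st.2 t) :=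
    ⟨fun p st => ∑ t, U (p.1, st.1) (p.2, t) * star (S st.2 t), fun _ _ => rfl⟩
  have : choi U β = G * Gᴴ := by
    ext p q
    simp only [choi, hS, hG, Matrix.mul_apply, Fintype.sum_prod_type, Matrix.conjTranspose_apply,
      star_sum, star_mul', star_star, Finset.sum_mul, Finset.mul_sum]
    refine Finset.sum_congr rfl fun s _ => ?_
    conv_lhs =>
      enter [2, t]
      rw [Finset.sum_comm]
    rw [Finset.sum_comm]
    refine Finset.sum_congr rfl fun m _ => ?_
    rw [Finset.sum_comm]
    refine Finset.sum_congr rfl fun t _ => Finset.sum_congr rfl fun t' _ => ?_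
    ring
  rw [this]
  exact Matrix.posSemidef_self_mul_conjTranspose G

lemma choi_tp {k : ℕ} (U : Matrix (Fin 2 × Fin k) (Fin 2 × Fin k) ℂ) (hU : IsUnitary U)
    (β : Matrix (Fin k) (Fin k) ℂ) (hβ : β.trace = 1) (a b : Fin 2) :
    ∑ i, choi U β (i, a) (i, b) = if a = b then 1 else 0 := by
  have h : ∀ t t', ∑ i, ∑ s, U (i, s) (a, t) * star (U (i, s) (b, t')) =
      if b = a ∧ t' = t then 1 else 0 := by
    intro t t'
    have := congrFun (congrFun hU.2 (b, t')) (a, t)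
    simp only [Matrix.mul_apply, Fintype.sum_prod_type, Matrix.conjTranspose_apply,
      Matrix.one_apply, Prod.mk.injEq] at this
    rw [← this]
    simp only [mul_comm]
  have : ∑ i, choi U β (i, a) (i, b) = ∑ t, ∑ t', β t t' *
      ∑ i, ∑ s, U (i, s) (a, t) * star (U (i, s) (b, t')) := by
    simp only [choi, Finset.mul_sum, Fin.sum_univ_two, ← Finset.sum_add_distrib]
    rw [Finset.sum_comm]
    refine Finset.sum_congr rfl fun t _ => ?_
    rw [Finset.sum_comm]
    refine Finset.sum_congr rfl fun t' _ => Finset.sum_congr rfl fun s _ => ?_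
    ring
  rw [this]
  simp only [h]
  by_cases hab : a = b
  · subst hab
    simpa [Matrix.trace] using hβ
  · have : ¬ b = a := fun h => hab h.symm
    simp [hab, this]

lemma channel_one {k : ℕ} (U : Matrix (Fin 2 × Fin k) (Fin 2 × Fin k) ℂ)
    (β : Matrix (Fin k) (Fin k) ℂ) (i j : Fin 2) :
    channel U β 1 i j = ∑ t, ∑ t', β t t' * (pt U * (pt U)ᴴ) (i, t) (j, t') := by
  rw [channel_choi]
  simp only [choi, pt, Finset.mul_sum, Fin.sum_univ_two, ← Finset.sum_add_distrib, Matrix.mul_apply,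
    Fintype.sum_prod_type, Matrix.conjTranspose_apply]
  rw [Finset.sum_comm]
  refine Finset.sum_congr rfl fun t _ => ?_
  rw [Finset.sum_comm]
  refine Finset.sum_congr rfl fun t' _ => Finset.sum_congr rfl fun s _ => ?_
  simp
  ring

lemma sesq_zero {k : ℕ} (N : Fin k → Fin k → ℂ)
    (h : ∀ v : Fin k → ℂ, ∑ t, ∑ t', v t * star (v t') * N t t' = 0) (t t' : Fin k) :
    N t t' = 0 := by
  have key : ∀ (c : ℂ), N t t + star c * N t t' + c * N t' t + c * star c * N t' t' = 0 := by
    intro c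
    have := h (fun s => (if s = t then 1 else 0) + c * (if s = t' then 1 else 0))
    simp only [star_add, star_mul', apply_ite star, star_one, star_zero] at this
    simp [add_mul, mul_add, Finset.sum_add_distrib, ← Finset.mul_sum, ← Finset.sum_mul] at this
    simp only [Complex.star_def]
    linear_combination this
  have k0 := key 0
  have k1 := key 1
  have k2 := key (-1)
  have k3 := key Complex.I
  have k4 := key (-Complex.I)
  simp at k0 k1 k2 k3 k4
  have hI := Complex.I_mul_I
  grind

lemma unital_iff {k : ℕ} (U : Matrix (Fin 2 × Fin k) (Fin 2 × Fin k) ℂ) :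
    (∀ β : Matrix (Fin k) (Fin k) ℂ, IsDensity β → channel U β 1 = 1) ↔ IsUnitary (pt U) := by
  constructor
  · intro h
    have : pt U * (pt U)ᴴ = 1 := by
      ext ⟨i, t⟩ ⟨j, t'⟩
      rw [← sub_eq_zero]
      refine sesq_zero (fun t t' => (pt U * (pt U)ᴴ) (i, t) (j, t') -
        (1 : Matrix (Fin 2 × Fin k) (Fin 2 × Fin k) ℂ) (i, t) (j, t')) ?_ t t'
      intro v
      by_cases hv : v = 0
      · simp [hv]
      have hne : v ⬝ᵥ star v ≠ 0 := by
        simpa using hv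
      have hnn : 0 ≤ v ⬝ᵥ star v := by
        simp
      have hd : IsDensity ((v ⬝ᵥ star v)⁻¹ • vecMulVec v (star v)) := by
        refine ⟨(Matrix.posSemidef_vecMulVec_self_star v).smul (inv_nonneg.mpr hnn), ?_⟩
        rw [Matrix.trace_smul, Matrix.trace_vecMulVec, smul_eq_mul, inv_mul_cancel₀ hne]
      have := congrFun (congrFun (h _ hd) i) j
      rw [channel_one] at this
      simp only [Matrix.smul_apply, smul_eq_mul, vecMulVec_apply, Pi.star_apply, mul_assoc,
        ← Finset.mul_sum] at this
      rw [inv_mul_eq_iff_eq_mul₀ hne] at this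
      simp only [mul_sub, Finset.sum_sub_distrib, mul_assoc, ← Finset.mul_sum]
      rw [this]
      simp only [Matrix.one_apply, Prod.mk.injEq, dotProduct]
      by_cases hij : i = j <;> simp [hij]
    exact ⟨this, mul_eq_one_comm.mp this⟩
  · intro h β hβ
    ext i j
    rw [channel_one, h.1]
    have := hβ.2
    simp only [Matrix.one_apply, Prod.mk.injEq]
    by_cases hij : i = j
    · simpa [hij, Matrix.trace] using this
    · simp [hij]

lemma unital_mixed {k : ℕ} (U : Matrix (Fin 2 × Fin k) (Fin 2 × Fin k) ℂ) (hU : IsUnitary U)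
    (β : Matrix (Fin k) (Fin k) ℂ) (hβ : IsDensity β) (h : channel U β 1 = 1) :
    IsMixedUnitary (channel U β) := by
  obtain ⟨p, Us, hp, hs, hUs, hC⟩ := qubit (choi U β) (choi_posSemidef U β hβ.1)
    (choi_tp U hU β hβ.2) (by
      intro i j
      have := congrFun (congrFun h i) j
      rw [channel_choi, Matrix.one_apply] at this
      rw [← this]
      simp [Matrix.one_apply])
  refine ⟨4, p, Us, hp, hs, hUs, fun X => ?_⟩
  ext i j
  rw [channel_choi]
  simp only [hC, Matrix.sum_apply, Matrix.smul_apply, Matrix.mul_apply, Matrix.conjTranspose_apply,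
    Fin.sum_univ_two, Fin.sum_univ_four, smul_eq_mul]
  ring

lemma mixed_unital {L : Matrix (Fin 2) (Fin 2) ℂ → Matrix (Fin 2) (Fin 2) ℂ}
    (h : IsMixedUnitary L) : L 1 = 1 := by
  obtain ⟨r, p, Us, hp, hs, hUs, hL⟩ := h
  rw [hL]
  simp only [Matrix.mul_one, (hUs _).1, ← Finset.sum_smul]
  have : ∑ i, (p i : ℂ) = 1 := by exact_mod_cast hs
  rw [this, one_smul]

/-- for `n = 2`, a bipartite unitary yields mixed unitary channels for
all ancilla states iff it yields unital channels for all ancilla states iff its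
partial transpose is unitary. -/
theorem stmt10 (k : ℕ) (hk : 2 ≤ k)
    (U : Matrix (Fin 2 × Fin k) (Fin 2 × Fin k) ℂ) (hU : IsUnitary U) :
    ((∀ β : Matrix (Fin k) (Fin k) ℂ, IsDensity β → IsMixedUnitary (channel U β)) ↔
      (∀ β : Matrix (Fin k) (Fin k) ℂ, IsDensity β → channel U β 1 = 1)) ∧
    ((∀ β : Matrix (Fin k) (Fin k) ℂ, IsDensity β → channel U β 1 = 1) ↔
      IsUnitary (pt U)) := by
  refine ⟨⟨fun h β hβ => mixed_unital (h β hβ), fun h β hβ => unital_mixed U hU β hβ (h β hβ)⟩,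
    unital_iff U⟩

end BipartiteUnitary
end
end

section
/- Let U be a unitary operator on ℂ^n ⊗ ℂ^k, let {E_α}_{α=1}^{n²} be an orthonormal basis of M_n(ℂ) for the Hilbert–Schmidt inner product, and define X_α := [Tr ⊗ id]((E_α* ⊗ I_k) U) ∈ M_k(ℂ) for α = 1, …, n². Then U belongs to U^A_block-diag if and only if all the operators X_α X_β* (α, β = 1, …, n²) are normal and pairwise commute, and all the operators X_α* X_β (α, β = 1, …, n²) are normal and pairwise commute. -/
open Matrix Kronecker ComplexOrder

noncomputable section

namespace BipartiteUnitary

/-- An orthonormal basis of `M_n(ℂ)` for the Hilbert–Schmidt inner product. -/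
def HSONB {n : ℕ} (E : Fin (n ^ 2) → Matrix (Fin n) (Fin n) ℂ) : Prop :=
  ∀ a b, ((E a)ᴴ * E b).trace = if a = b then (1 : ℂ) else 0

/-- The operator `X_A = [Tr ⊗ id]((A* ⊗ I_k) U)`. -/
def Xof {n k : ℕ} (U : Matrix (Fin n × Fin k) (Fin n × Fin k) ℂ)
    (A : Matrix (Fin n) (Fin n) ℂ) : Matrix (Fin k) (Fin k) ℂ :=
  trA ((Aᴴ ⊗ₖ (1 : Matrix (Fin k) (Fin k) ℂ)) * U)

lemma joint_diag {k : ℕ} {ι : Type*} (H : ι → Matrix (Fin k) (Fin k) ℂ)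
    (hH : ∀ i, (H i).IsHermitian) (hc : ∀ i j, Commute (H i) (H j)) :
    ∃ f : Fin k → Fin k → ℂ, ONB f ∧ ∀ j i, ∃ μ : ℂ, H i *ᵥ f j = μ • f j := by
  classical
  let T : ι → Module.End ℂ (EuclideanSpace ℂ (Fin k)) := fun i => Matrix.toEuclideanLin (H i)
  have hT : ∀ i, (T i).IsSymmetric := fun i => Matrix.isSymmetric_toEuclideanLin_iff.mpr (hH i)
  have hC : Pairwise (Function.onFun Commute T) := by
    intro i j _
    have := (hc i j).eq
    show T i * T j = T j * T i
    ext v : 1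
    simp only [T, Module.End.mul_apply, Matrix.toLpLin_apply, Matrix.mulVec_mulVec, this]
  have hint := LinearMap.IsSymmetric.directSum_isInternal_of_pairwise_commute hT hC
  have horth := LinearMap.IsSymmetric.orthogonalFamily_iInf_eigenspaces hT
  have := hint.submodule_iSupIndep.fintypeNeBotOfFiniteDimensional
  have hint' := DirectSum.isInternal_ne_bot_iff.mpr hint
  have horth' := horth.comp (γ := {i : ι → ℂ // (⨅ j, Module.End.eigenspace (T j) (i j)) ≠ ⊥})
    Subtype.val_injective
  have hn : Module.finrank ℂ (EuclideanSpace ℂ (Fin k)) = k := by simp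
  let b := hint'.subordinateOrthonormalBasis hn horth'
  refine ⟨fun j => (b j).ofLp, ?_, ?_⟩
  · intro i j
    have := orthonormal_iff_ite.mp b.orthonormal i j
    rw [← this]
    simp [PiLp.inner_apply, mul_comm]
  · intro j i
    have h := hint'.subordinateOrthonormalBasis_subordinate hn j horth'
    refine ⟨(hint'.subordinateOrthonormalBasisIndex hn j horth').1 i, ?_⟩
    have h2 := (Submodule.mem_iInf _).mp h i
    rw [Module.End.mem_eigenspace_iff] at h2
    have h3 := congrArg WithLp.ofLp h2
    simpa [T, Matrix.toLpLin_apply] using h3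

/-- matrix whose columns are the vectors -/
def colMat {k : ℕ} (f : Fin k → Fin k → ℂ) : Matrix (Fin k) (Fin k) ℂ := fun s i => f i s

lemma onb_iff {k : ℕ} (f : Fin k → Fin k → ℂ) : ONB f ↔ (colMat f)ᴴ * colMat f = 1 := by
  constructor
  · intro h
    ext i j
    simpa [Matrix.mul_apply, Matrix.one_apply, colMat] using h i j
  · intro h i j
    have := congrFun (congrFun h i) j
    simpa [Matrix.mul_apply, Matrix.one_apply, colMat] using this

lemma sum_eq_block {n k : ℕ} (Us : Fin k → Matrix (Fin n) (Fin n) ℂ) (e f : Fin k → Fin k → ℂ) :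
    ∑ i, Us i ⊗ₖ vecMulVec (e i) (star (f i)) =
      ((1 : Matrix (Fin n) (Fin n) ℂ) ⊗ₖ colMat e) * blockDiagonal Us *
        ((1 : Matrix (Fin n) (Fin n) ℂ) ⊗ₖ (colMat f)ᴴ) := by
  ext ⟨x, s⟩ ⟨y, t⟩
  simp only [Matrix.sum_apply, Matrix.mul_apply, Fintype.sum_prod_type, kroneckerMap_apply,
    Matrix.one_apply, blockDiagonal_apply, vecMulVec_apply, colMat, conjTranspose_apply]
  simp [Finset.sum_ite_eq, ite_mul, mul_ite]
  refine Finset.sum_congr rfl fun i _ => ?_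
  ring

lemma Xof_conj {n k : ℕ} (P Q : Matrix (Fin k) (Fin k) ℂ)
    (M : Matrix (Fin n × Fin k) (Fin n × Fin k) ℂ) (A : Matrix (Fin n) (Fin n) ℂ) :
    Xof (((1 : Matrix (Fin n) (Fin n) ℂ) ⊗ₖ P) * M * ((1 : Matrix (Fin n) (Fin n) ℂ) ⊗ₖ Q)) A
      = P * Xof M A * Q := by
  have h1 : (Aᴴ ⊗ₖ (1 : Matrix (Fin k) (Fin k) ℂ)) *
      (((1 : Matrix (Fin n) (Fin n) ℂ) ⊗ₖ P) * M * ((1 : Matrix (Fin n) (Fin n) ℂ) ⊗ₖ Q)) =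
      ((1 : Matrix (Fin n) (Fin n) ℂ) ⊗ₖ P) * ((Aᴴ ⊗ₖ (1 : Matrix (Fin k) (Fin k) ℂ)) * M) *
        ((1 : Matrix (Fin n) (Fin n) ℂ) ⊗ₖ Q) := by
    simp only [← Matrix.mul_assoc, ← Matrix.mul_kronecker_mul, Matrix.one_mul, Matrix.mul_one]
  unfold Xof
  rw [h1]
  generalize (Aᴴ ⊗ₖ (1 : Matrix (Fin k) (Fin k) ℂ)) * M = N
  ext s t
  simp only [trA, Matrix.mul_apply, Fintype.sum_prod_type, kroneckerMap_apply, Matrix.one_apply]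
  simp [Finset.sum_ite_eq, ite_mul, mul_ite, Finset.sum_mul, Finset.mul_sum]
  rw [Finset.sum_comm]
  refine Finset.sum_congr rfl fun i _ => ?_
  rw [Finset.sum_comm]

lemma Xof_block {n k : ℕ} (Us : Fin k → Matrix (Fin n) (Fin n) ℂ) (A : Matrix (Fin n) (Fin n) ℂ) :
    Xof (blockDiagonal Us) A = diagonal fun i => (Aᴴ * Us i).trace := by
  ext s t
  simp only [Xof, trA, Matrix.mul_apply, Fintype.sum_prod_type, kroneckerMap_apply,
    Matrix.one_apply, blockDiagonal_apply, diagonal_apply, Matrix.trace, Matrix.diag]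
  by_cases h : s = t
  · subst h; simp
  · simp [h]

lemma expand {n k : ℕ} (U : Matrix (Fin n × Fin k) (Fin n × Fin k) ℂ)
    (E : Fin (n ^ 2) → Matrix (Fin n) (Fin n) ℂ) (hE : HSONB E) :
    U = ∑ a, E a ⊗ₖ Xof U (E a) := by
  let P : Matrix (Fin n × Fin n) (Fin (n ^ 2)) ℂ := Matrix.of fun p a => E a p.1 p.2
  have h1 : Pᴴ * P = 1 := by
    ext a b
    have := hE a b
    rw [Matrix.one_apply, ← this]
    simp only [Matrix.mul_apply, Matrix.trace, Matrix.diag, conjTranspose_apply, P,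
      Fintype.sum_prod_type, Matrix.of_apply]
    rw [Finset.sum_comm]
  have h2 : P * Pᴴ = 1 :=
    (Matrix.mul_eq_one_comm_of_card_eq _ _ _ (by simp [sq])).mp h1
  have h3 : ∀ x y z w, ∑ a, E a x y * star (E a z w) = if x = z ∧ y = w then 1 else 0 := by
    intro x y z w
    have := congrFun (congrFun h2 (x, y)) (z, w)
    simpa [Matrix.mul_apply, Matrix.one_apply, P] using this
  ext ⟨x, s⟩ ⟨y, t⟩
  have h4 : ∀ a, Xof U (E a) s t = ∑ z, ∑ w, star (E a w z) * U (w, s) (z, t) := by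
    intro a
    simp [Xof, trA, Matrix.mul_apply, Fintype.sum_prod_type, Matrix.one_apply]
  simp only [Matrix.sum_apply, kroneckerMap_apply, h4, Finset.mul_sum]
  rw [Finset.sum_comm]
  have : ∀ z, ∑ a, ∑ w, E a x y * (star (E a w z) * U (w, s) (z, t)) =
      ∑ w, (if x = w ∧ y = z then 1 else 0) * U (w, s) (z, t) := by
    intro z
    rw [Finset.sum_comm]
    refine Finset.sum_congr rfl fun w _ => ?_
    rw [← h3, Finset.sum_mul]
    exact Finset.sum_congr rfl fun a _ => by ring
  simp only [this, ite_and]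
  simp

lemma unitary_blocks {n k : ℕ} (Us : Fin k → Matrix (Fin n) (Fin n) ℂ)
    (P Q : Matrix (Fin k) (Fin k) ℂ) (hP : Pᴴ * P = 1) (hQ : Qᴴ * Q = 1)
    (hU : IsUnitary (((1 : Matrix (Fin n) (Fin n) ℂ) ⊗ₖ P) * blockDiagonal Us *
        ((1 : Matrix (Fin n) (Fin n) ℂ) ⊗ₖ Qᴴ))) : ∀ i, IsUnitary (Us i) := by
  set P' := ((1 : Matrix (Fin n) (Fin n) ℂ) ⊗ₖ P) with hP'
  set Q' := ((1 : Matrix (Fin n) (Fin n) ℂ) ⊗ₖ Q) with hQ'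
  have e1 : ((1 : Matrix (Fin n) (Fin n) ℂ) ⊗ₖ Qᴴ) = Q'ᴴ := by
    simp [hQ', conjTranspose_kronecker]
  have p1 : P'ᴴ * P' = 1 := by
    simp [hP', conjTranspose_kronecker, ← Matrix.mul_kronecker_mul, hP]
  have q1 : Q'ᴴ * Q' = 1 := by
    simp [hQ', conjTranspose_kronecker, ← Matrix.mul_kronecker_mul, hQ]
  rw [e1] at hU
  have h := hU.2
  have key : (blockDiagonal Us)ᴴ * blockDiagonal Us = 1 := by
    have h5 : Q'ᴴ * (((P' * blockDiagonal Us * Q'ᴴ)ᴴ * (P' * blockDiagonal Us * Q'ᴴ))) * Q' =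
        (Q'ᴴ * Q') * (blockDiagonal Us)ᴴ * (P'ᴴ * P') * blockDiagonal Us * (Q'ᴴ * Q') := by
      simp only [conjTranspose_mul, conjTranspose_conjTranspose, Matrix.mul_assoc]
    rw [h, p1, q1] at h5
    simpa [q1] using h5.symm
  rw [blockDiagonal_conjTranspose, ← blockDiagonal_mul, ← blockDiagonal_one,
    blockDiagonal_inj] at key
  intro i
  have := congrFun key i
  exact ⟨mul_eq_one_comm.mp this, this⟩

lemma forward_s13 {n k : ℕ} (U : Matrix (Fin n × Fin k) (Fin n × Fin k) ℂ) (h : memUA U) :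
    ∃ (P Q : Matrix (Fin k) (Fin k) ℂ) (d : Matrix (Fin n) (Fin n) ℂ → Fin k → ℂ),
      Pᴴ * P = 1 ∧ Qᴴ * Q = 1 ∧ ∀ A, Xof U A = P * diagonal (d A) * Qᴴ := by
  obtain ⟨Us, e, f, -, he, hf, rfl⟩ := h
  refine ⟨colMat e, colMat f, fun A i => (Aᴴ * Us i).trace, (onb_iff e).mp he, (onb_iff f).mp hf,
    fun A => ?_⟩
  rw [sum_eq_block, Xof_conj, Xof_block]

lemma conj_mul {k : ℕ} {P : Matrix (Fin k) (Fin k) ℂ} (hP : Pᴴ * P = 1)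
    (A B : Matrix (Fin k) (Fin k) ℂ) : P * A * Pᴴ * (P * B * Pᴴ) = P * (A * B) * Pᴴ := by
  calc _ = P * A * (Pᴴ * P) * B * Pᴴ := by simp only [Matrix.mul_assoc]
    _ = _ := by rw [hP]; simp only [Matrix.mul_assoc, Matrix.one_mul]

lemma comm_diag {k : ℕ} {P : Matrix (Fin k) (Fin k) ℂ} (hP : Pᴴ * P = 1) (a b : Fin k → ℂ) :
    Commute (P * diagonal a * Pᴴ) (P * diagonal b * Pᴴ) := by
  show _ * _ = _ * _
  rw [conj_mul hP, conj_mul hP, diagonal_mul_diagonal, diagonal_mul_diagonal]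
  simp only [mul_comm]

lemma normal_diag {k : ℕ} {P : Matrix (Fin k) (Fin k) ℂ} (hP : Pᴴ * P = 1) (a : Fin k → ℂ) :
    IsStarNormal (P * diagonal a * Pᴴ) := by
  constructor
  have : star (P * diagonal a * Pᴴ) = P * diagonal (star a) * Pᴴ := by
    simp [star_eq_conjTranspose, conjTranspose_mul, Matrix.mul_assoc, diagonal_conjTranspose]
  rw [this]
  exact comm_diag hP _ _

lemma prod_form {k : ℕ} {P Q : Matrix (Fin k) (Fin k) ℂ} (hQ : Qᴴ * Q = 1) (a b : Fin k → ℂ) :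
    (P * diagonal a * Qᴴ) * (P * diagonal b * Qᴴ)ᴴ = P * diagonal (a * star b) * Pᴴ := by
  have : (P * diagonal a * Qᴴ) * (P * diagonal b * Qᴴ)ᴴ =
      P * (diagonal a * (Qᴴ * Q) * (diagonal b)ᴴ) * Pᴴ := by
    simp [conjTranspose_mul, Matrix.mul_assoc]
  rw [this, hQ, Matrix.mul_one, diagonal_conjTranspose, diagonal_mul_diagonal]
  rfl

lemma prod_form' {k : ℕ} {P Q : Matrix (Fin k) (Fin k) ℂ} (hP : Pᴴ * P = 1) (a b : Fin k → ℂ) :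
    (P * diagonal a * Qᴴ)ᴴ * (P * diagonal b * Qᴴ) = Q * diagonal (star a * b) * Qᴴ := by
  have : (P * diagonal a * Qᴴ)ᴴ * (P * diagonal b * Qᴴ) =
      Q * ((diagonal a)ᴴ * (Pᴴ * P) * diagonal b) * Qᴴ := by
    simp [conjTranspose_mul, Matrix.mul_assoc]
  rw [this, hP, Matrix.mul_one, diagonal_conjTranspose, diagonal_mul_diagonal]
  rfl

/-- Orthonormal joint eigenbasis of all `X_a* X_b`. -/
lemma joint_eig {k : ℕ} {ι : Type*} (X : ι → Matrix (Fin k) (Fin k) ℂ)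
    (hc : ∀ a b c d, Commute ((X a)ᴴ * X b) ((X c)ᴴ * X d)) :
    ∃ f : Fin k → Fin k → ℂ, ONB f ∧
      ∀ j a b, ∃ μ : ℂ, ((X a)ᴴ * X b) *ᵥ f j = μ • f j := by
  obtain ⟨f, hf, h⟩ := joint_diag
    (fun p : (ι × ι) ⊕ (ι × ι) => match p with
      | Sum.inl p => (X p.1)ᴴ * X p.2 + (X p.2)ᴴ * X p.1
      | Sum.inr p => Complex.I • ((X p.1)ᴴ * X p.2 - (X p.2)ᴴ * X p.1))
    (by
      rintro (p | p)
      · simp [Matrix.IsHermitian, conjTranspose_mul, add_comm]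
      · simp [Matrix.IsHermitian, conjTranspose_mul, conjTranspose_smul]
        module)
    (by
      rintro (p | p) (q | q)
      · exact ((hc _ _ _ _).add_right (hc _ _ _ _)).add_left ((hc _ _ _ _).add_right (hc _ _ _ _))
      · exact (((hc _ _ _ _).sub_right (hc _ _ _ _)).add_left
          ((hc _ _ _ _).sub_right (hc _ _ _ _))).smul_right _
      · exact (((hc _ _ _ _).add_right (hc _ _ _ _)).sub_left
          ((hc _ _ _ _).add_right (hc _ _ _ _))).smul_left _
      · exact ((((hc _ _ _ _).sub_right (hc _ _ _ _)).sub_left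
          ((hc _ _ _ _).sub_right (hc _ _ _ _))).smul_left _).smul_right _)
  refine ⟨f, hf, fun j a b => ?_⟩
  obtain ⟨μ, hμ⟩ := h j (Sum.inl (a, b))
  obtain ⟨ν, hν⟩ := h j (Sum.inr (a, b))
  refine ⟨(μ - Complex.I * ν) / 2, ?_⟩
  have key : (X a)ᴴ * X b = (1 / 2 : ℂ) • (((X a)ᴴ * X b + (X b)ᴴ * X a) -
      Complex.I • (Complex.I • ((X a)ᴴ * X b - (X b)ᴴ * X a))) := by
    rw [smul_smul, Complex.I_mul_I]
    module
  rw [key, Matrix.smul_mulVec, Matrix.sub_mulVec, Matrix.smul_mulVec]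
  simp only at hμ hν
  rw [hμ, hν]
  module

lemma sim_svd {k : ℕ} {ι : Type*} (X : ι → Matrix (Fin k) (Fin k) ℂ)
    (h1 : ∀ a b c d, Commute (X a * (X b)ᴴ) (X c * (X d)ᴴ))
    (hc : ∀ a b c d, Commute ((X a)ᴴ * X b) ((X c)ᴴ * X d))
    (hne : ∀ v, (∀ a, X a *ᵥ v = 0) → v = 0) :
    ∃ (e f : Fin k → Fin k → ℂ) (c : ι → Fin k → ℂ), ONB e ∧ ONB f ∧
      ∀ a, X a = colMat e * diagonal (c a) * (colMat f)ᴴ := by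
  obtain ⟨f, hf, h⟩ := joint_eig X hc
  choose μ hμ using h
  have hinner : ∀ i j a b, star (X a *ᵥ f i) ⬝ᵥ (X b *ᵥ f j) =
      if i = j then μ j a b else 0 := by
    intro i j a b
    rw [star_mulVec, ← dotProduct_mulVec, mulVec_mulVec, hμ, dotProduct_smul]
    have : star (f i) ⬝ᵥ f j = if i = j then (1 : ℂ) else 0 := hf i j
    rw [this]
    split_ifs <;> simp
  have hex : ∀ i, ∃ a, X a *ᵥ f i ≠ 0 := by
    intro i
    by_contra! hcon
    have := hne _ hcon
    have h2 := hf i i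
    simp [this] at h2
  choose E hEne using hex
  have hpos : ∀ i, μ i (E i) (E i) ≠ 0 := by
    intro i h0
    have := hinner i i (E i) (E i)
    simp only [if_true, h0] at this
    exact hEne i (dotProduct_star_self_eq_zero.mp this)
  have hr : ∀ i, ∃ r : ℝ, r ≠ 0 ∧ μ i (E i) (E i) = (r : ℂ) * r := by
    intro i
    have h3 := hinner i i (E i) (E i)
    simp only [if_true] at h3
    have h4 : 0 ≤ μ i (E i) (E i) := by
      rw [← h3]; exact dotProduct_star_self_nonneg _
    obtain ⟨h5, h6⟩ := Complex.nonneg_iff.mp h4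
    have h7 : μ i (E i) (E i) = ((μ i (E i) (E i)).re : ℂ) := by
      apply Complex.ext <;> simp [← h6]
    have h8 : Real.sqrt (μ i (E i) (E i)).re * Real.sqrt (μ i (E i) (E i)).re =
      (μ i (E i) (E i)).re := Real.mul_self_sqrt h5
    refine ⟨Real.sqrt (μ i (E i) (E i)).re, ?_, ?_⟩
    · intro h0
      rw [h0] at h8
      apply hpos i
      rw [h7, ← h8]; simp
    · rw [← Complex.ofReal_mul, h8]; exact h7
  choose r hr0 hr using hr
  have hprop : ∀ i a, X a *ᵥ f i = (μ i (E i) a / μ i (E i) (E i)) • (X (E i) *ᵥ f i) := by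
    intro i a
    set ε := E i with hε
    have hcomm := congrArg (fun M => M *ᵥ (X ε *ᵥ f i)) (h1 a ε ε ε).eq
    have hx : ∀ p q s t, (X p * (X q)ᴴ * (X s * (X t)ᴴ)) *ᵥ (X ε *ᵥ f i) =
        (μ i t ε * μ i q s) • (X p *ᵥ f i) := by
      intro p q s t
      have : (X p * (X q)ᴴ * (X s * (X t)ᴴ)) *ᵥ (X ε *ᵥ f i) =
          X p *ᵥ (((X q)ᴴ * X s) *ᵥ (((X t)ᴴ * X ε) *ᵥ f i)) := by
        simp only [mulVec_mulVec, Matrix.mul_assoc]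
      rw [this, hμ, mulVec_smul, hμ, mulVec_smul, mulVec_smul, smul_smul]
    simp only [hx] at hcomm
    have hp := hpos i
    have h9 : X a *ᵥ f i = (μ i ε ε * μ i ε ε)⁻¹ • ((μ i ε ε * μ i ε ε) • (X a *ᵥ f i)) := by
      rw [smul_smul, inv_mul_cancel₀ (mul_ne_zero hp hp), one_smul]
    rw [h9, hcomm, smul_smul]
    congr 1
    field_simp
  let e : Fin k → Fin k → ℂ := fun i => ((r i : ℂ)⁻¹) • (X (E i) *ᵥ f i)
  have he : ONB e := by
    intro i j
    have : star (e i) ⬝ᵥ e j = if i = j then (1 : ℂ) else 0 := by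
      simp only [e, star_smul, smul_dotProduct, dotProduct_smul, hinner]
      by_cases hij : i = j
      · subst hij
        have : (r i : ℂ) ≠ 0 := by exact_mod_cast hr0 i
        simp [hr]
        field_simp
      · simp [hij]
    exact this
  refine ⟨e, f, fun a i => μ i (E i) a / r i, he, hf, fun a => ?_⟩
  have hF : colMat f * (colMat f)ᴴ = 1 := mul_eq_one_comm.mp ((onb_iff f).mp hf)
  have hXF : X a * colMat f = colMat e * diagonal (fun i => μ i (E i) a / r i) := by
    ext s i
    rw [mul_diagonal]
    have h10 : (X a * colMat f) s i = (X a *ᵥ f i) s := rfl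
    have : (r i : ℂ) ≠ 0 := by exact_mod_cast hr0 i
    rw [h10, hprop]
    simp only [colMat, e, Pi.smul_apply, smul_eq_mul, hr]
    field_simp
  rw [← hXF, Matrix.mul_assoc, hF, Matrix.mul_one]

lemma nonzero_of_unitary {n k : ℕ} (hn : 0 < n) (U : Matrix (Fin n × Fin k) (Fin n × Fin k) ℂ)
    (hU : IsUnitary U) (E : Fin (n ^ 2) → Matrix (Fin n) (Fin n) ℂ) (hE : HSONB E)
    (v : Fin k → ℂ) (hv : ∀ a, Xof U (E a) *ᵥ v = 0) : v = 0 := by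
  let w : Fin n × Fin k → ℂ := fun p => if p.1 = ⟨0, hn⟩ then v p.2 else 0
  have h0 : U *ᵥ w = 0 := by
    rw [expand U E hE, Matrix.sum_mulVec]
    refine Finset.sum_eq_zero fun a _ => ?_
    ext ⟨x, s⟩
    have := congrFun (hv a) s
    simp only [mulVec, dotProduct, Pi.zero_apply] at this
    simp only [mulVec, dotProduct, Fintype.sum_prod_type, kroneckerMap_apply, w, Pi.zero_apply]
    simp [mul_assoc, ← Finset.mul_sum, this]
  have h1 : w = 0 := by
    rw [← Matrix.one_mulVec w, ← hU.2, ← mulVec_mulVec, h0, mulVec_zero]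
  ext s
  simpa [w] using congrFun h1 (⟨0, hn⟩, s)

/-- a bipartite unitary is in `𝒰^A_{block-diag}` iff the operators
`X_α X_β*` are normal and pairwise commute, and likewise for `X_α* X_β`. -/
theorem stmt13 (n k : ℕ)
    (U : Matrix (Fin n × Fin k) (Fin n × Fin k) ℂ) (hU : IsUnitary U)
    (E : Fin (n ^ 2) → Matrix (Fin n) (Fin n) ℂ) (hE : HSONB E) :
    memUA U ↔
      ((∀ a b, IsStarNormal (Xof U (E a) * (Xof U (E b))ᴴ)) ∧
       (∀ a b c d, Commute (Xof U (E a) * (Xof U (E b))ᴴ)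
          (Xof U (E c) * (Xof U (E d))ᴴ)) ∧
       (∀ a b, IsStarNormal ((Xof U (E a))ᴴ * Xof U (E b))) ∧
       (∀ a b c d, Commute ((Xof U (E a))ᴴ * Xof U (E b))
          ((Xof U (E c))ᴴ * Xof U (E d)))) := by
  constructor
  · intro h
    obtain ⟨P, Q, d, hP, hQ, hX⟩ := forward_s13 U h
    simp only [hX, prod_form hQ, prod_form' hP]
    exact ⟨fun _ _ => normal_diag hP _, fun _ _ _ _ => comm_diag hP _ _,
      fun _ _ => normal_diag hQ _, fun _ _ _ _ => comm_diag hQ _ _⟩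
  · rintro ⟨-, h1, -, h2⟩
    rcases Nat.eq_zero_or_pos n with hn | hn
    · subst hn
      have h1 : ONB (fun i : Fin k => (Pi.single i 1 : Fin k → ℂ)) := by
        intro i j
        simp [Pi.single_apply, eq_comm]
      refine ⟨fun _ => 1, _, _, fun _ => ⟨by simp, by simp⟩, h1, h1, ?_⟩
      ext ⟨x, s⟩
      exact x.elim0
    · obtain ⟨e, f, c, he, hf, hX⟩ := sim_svd (fun a => Xof U (E a)) h1 h2
        (nonzero_of_unitary hn U hU E hE)
      have hUeq : U = ∑ i, (∑ a, c a i • E a) ⊗ₖ vecMulVec (e i) (star (f i)) := by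
        rw [sum_eq_block]
        conv_lhs => rw [expand U E hE]
        have hb : blockDiagonal (fun i => ∑ a, c a i • E a) =
            ∑ a, E a ⊗ₖ diagonal (c a) := by
          ext ⟨x, s⟩ ⟨y, t⟩
          simp only [blockDiagonal_apply, Matrix.sum_apply, kroneckerMap_apply, diagonal_apply]
          by_cases hst : s = t
          · simp [hst, mul_comm]
          · simp [hst]
        rw [hb, Finset.mul_sum, Finset.sum_mul]
        refine Finset.sum_congr rfl fun a _ => ?_
        rw [← Matrix.mul_kronecker_mul, ← Matrix.mul_kronecker_mul, ← hX a]
        simp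
      refine ⟨_, e, f, ?_, he, hf, hUeq⟩
      rw [sum_eq_block] at hUeq
      rw [hUeq] at hU
      exact unitary_blocks _ _ _ ((onb_iff e).mp he) ((onb_iff f).mp hf) hU

end BipartiteUnitary
end
end

section
/- The sets U^A_block-diag and U_prob-lin are equal. That is, a unitary operator U on ℂ^n ⊗ ℂ^k admits fixed unitaries U_1, …, U_r on ℂ^n and functions p_1, …, p_r on M_k^{1,+}(ℂ) that extend to linear functionals on M_k(ℂ), with p_i(β) ≥ 0 and Σ_{i=1}^r p_i(β) = 1 for every density matrix β, such that L_{U,β}(X) = Σ_{i=1}^r p_i(β) U_i X U_i* for every β ∈ M_k^{1,+}(ℂ) and X ∈ M_n(ℂ), if and only if U = Σ_{i=1}^k V_i ⊗ e_if_i* for some unitaries V_i on ℂ^n and orthonormal bases {e_i}, {f_i} of ℂ^k. -/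
open Matrix Kronecker ComplexOrder

noncomputable section

namespace BipartiteUnitary

/-! Helper material. -/

/-- `V ⊗ |c⟩` as a matrix. -/
def DD {n k : ℕ} (V : Matrix (Fin n) (Fin n) ℂ) (c : Fin k → ℂ) :
    Matrix (Fin n × Fin k) (Fin n) ℂ := fun p b => V p.1 b * c p.2

lemma DD_mul {n k : ℕ} (V V' : Matrix (Fin n) (Fin n) ℂ) (c c' : Fin k → ℂ) :
    (DD V c)ᴴ * DD V' c' = (star c ⬝ᵥ c') • (Vᴴ * V') := by
  ext b b'
  simp only [DD, Matrix.mul_apply, conjTranspose_apply, Fintype.sum_prod_type, Matrix.smul_apply,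
    dotProduct, smul_eq_mul, Finset.sum_mul_sum, star_mul', Pi.star_apply]
  rw [Finset.sum_comm]
  refine Finset.sum_congr rfl fun s _ => Finset.sum_congr rfl fun a _ => ?_
  ring

lemma DD_mul_conj {n k : ℕ} (V : Matrix (Fin n) (Fin n) ℂ) (c f : Fin k → ℂ) :
    DD V c * (DD (n := n) 1 f)ᴴ = V ⊗ₖ vecMulVec c (star f) := by
  ext ⟨a, s⟩ ⟨b, t⟩
  simp [DD, Matrix.mul_apply, vecMulVec, Matrix.one_apply, kroneckerMap_apply, apply_ite]
  ring

lemma DD_mul_right {n k : ℕ} (A B : Matrix (Fin n) (Fin n) ℂ) (c : Fin k → ℂ) :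
    DD A c * B = DD (A * B) c := by
  ext p b
  simp only [DD, Matrix.mul_apply, Finset.sum_mul]
  exact Finset.sum_congr rfl fun x _ => by ring

lemma U_DD_apply {n k : ℕ} (U : Matrix (Fin n × Fin k) (Fin n × Fin k) ℂ) (r : Fin k → ℂ)
    (p : Fin n × Fin k) (b : Fin n) :
    (U * DD (n := n) 1 r) p b = ∑ t, U p (b, t) * r t := by
  simp [DD, Matrix.mul_apply, Fintype.sum_prod_type, Matrix.one_apply]

/-- Vectors on which `U` acts as a product. -/
def SS {n k : ℕ} (U : Matrix (Fin n × Fin k) (Fin n × Fin k) ℂ) (r : Fin k → ℂ) : Prop :=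
  ∃ V c, IsUnitary V ∧ U * DD (n := n) 1 r = DD V c

lemma gram {n k : ℕ} {U : Matrix (Fin n × Fin k) (Fin n × Fin k) ℂ} (hU : IsUnitary U)
    {r r' c c' : Fin k → ℂ} {V V' : Matrix (Fin n) (Fin n) ℂ}
    (h : U * DD (n := n) 1 r = DD V c) (h' : U * DD (n := n) 1 r' = DD V' c') :
    (star r ⬝ᵥ r') • (1 : Matrix (Fin n) (Fin n) ℂ) = (star c ⬝ᵥ c') • (Vᴴ * V') := by
  rw [← DD_mul, ← h, ← h', conjTranspose_mul, Matrix.mul_assoc, ← Matrix.mul_assoc Uᴴ, hU.2,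
    Matrix.one_mul, DD_mul]
  simp

lemma SS_step {n k : ℕ} [NeZero n] {U : Matrix (Fin n × Fin k) (Fin n × Fin k) ℂ}
    (hU : IsUnitary U) {e r : Fin k → ℂ} (he : SS U e) (hr : SS U r) :
    SS U (r - (star e ⬝ᵥ r) • e) := by
  obtain ⟨V, c, hV, h⟩ := he
  obtain ⟨V', c', hV', h'⟩ := hr
  have hg := gram hU h h'
  by_cases h0 : star e ⬝ᵥ r = 0
  · rw [h0]; simp; exact ⟨V', c', hV', h'⟩
  have hc : star c ⬝ᵥ c' ≠ 0 := by
    intro hc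
    rw [hc] at hg
    have := congrFun (congrFun hg 0) 0
    simp at this
    exact h0 this
  have hVV : V' = ((star c ⬝ᵥ c')⁻¹ * (star e ⬝ᵥ r)) • V := by
    have := congrArg (fun M => (star c ⬝ᵥ c')⁻¹ • (V * M)) hg
    simp only [Matrix.mul_smul, Matrix.mul_one, ← Matrix.mul_assoc, hV.1, Matrix.one_mul,
      smul_smul, inv_mul_cancel₀ hc, one_smul] at this
    exact this.symm
  refine ⟨V, ((star c ⬝ᵥ c')⁻¹ * (star e ⬝ᵥ r)) • c' - (star e ⬝ᵥ r) • c, hV, ?_⟩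
  ext p b
  have e1 := congrFun (congrFun h p) b
  have e2 := congrFun (congrFun h' p) b
  rw [hVV] at e2
  rw [U_DD_apply] at e1 e2 ⊢
  simp only [DD, Matrix.smul_apply, smul_eq_mul, Pi.sub_apply, Pi.smul_apply] at e1 e2 ⊢
  simp only [mul_sub, Finset.sum_sub_distrib]
  rw [e2]
  have : ∑ t, U p (b, t) * ((star e ⬝ᵥ r) * e t) = (star e ⬝ᵥ r) * ∑ t, U p (b, t) * e t := by
    rw [Finset.mul_sum]
    exact Finset.sum_congr rfl fun t _ => by ring
  rw [this, e1]
  ring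

lemma SS_smul {n k : ℕ} {U : Matrix (Fin n × Fin k) (Fin n × Fin k) ℂ}
    {r : Fin k → ℂ} (hr : SS U r) (a : ℂ) : SS U (a • r) := by
  obtain ⟨V, c, hV, h⟩ := hr
  refine ⟨V, a • c, hV, ?_⟩
  have h1 : ∀ W : Matrix (Fin n) (Fin n) ℂ, ∀ x : Fin k → ℂ, DD W (a • x) = a • DD W x := by
    intro W x
    ext p b
    simp [DD]
    ring
  rw [h1, h1, ← h, Matrix.mul_smul]

lemma exists_orthonormal {n k : ℕ} [NeZero n] {U : Matrix (Fin n × Fin k) (Fin n × Fin k) ℂ}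
    (hU : IsUnitary U)
    (hspan : Submodule.span ℂ {r : EuclideanSpace ℂ (Fin k) | SS U r.ofLp} = ⊤) (m : ℕ)
    (hm : m ≤ k) :
    ∃ e : Fin m → EuclideanSpace ℂ (Fin k), Orthonormal ℂ e ∧ ∀ i, SS U (e i).ofLp := by
  induction m with
  | zero => exact ⟨Fin.elim0, ⟨fun i => i.elim0, fun i => i.elim0⟩, fun i => i.elim0⟩
  | succ m ih =>
    obtain ⟨e, he, heS⟩ := ih (by omega)
    have hne : Submodule.span ℂ (Set.range e) ≠ ⊤ := by
      intro htop
      have h1 := finrank_range_le_card (R := ℂ) e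
      rw [Set.finrank, htop, finrank_top] at h1
      simp at h1
      omega
    obtain ⟨r, hrS, hr⟩ : ∃ r : EuclideanSpace ℂ (Fin k), SS U r.ofLp ∧
        r ∉ Submodule.span ℂ (Set.range e) := by
      by_contra! hcon
      apply hne
      rw [eq_top_iff, ← hspan, Submodule.span_le]
      exact fun r hr => hcon r hr
    have hres : ∀ T : Finset (Fin m),
        SS U (r - ∑ i ∈ T, inner ℂ (e i) r • e i).ofLp := by
      intro T
      induction T using Finset.induction_on with
      | empty => simpa using hrS
      | insert j T hj ihT =>
        have h2 := SS_step hU (heS j) ihT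
        have h3 : star (e j).ofLp ⬝ᵥ (r - ∑ i ∈ T, inner ℂ (e i) r • e i).ofLp
            = inner ℂ (e j) r := by
          have : inner ℂ (e j) (r - ∑ i ∈ T, inner ℂ (e i) r • e i) = inner ℂ (e j) r := by
            rw [inner_sub_right, inner_sum]
            rw [Finset.sum_eq_zero, sub_zero]
            intro i hi
            rw [inner_smul_right, he.2 (by rintro rfl; exact hj hi), mul_zero]
          rw [← this, EuclideanSpace.inner_eq_star_dotProduct, dotProduct_comm]
        rw [h3] at h2
        convert h2 using 1
        rw [Finset.sum_insert hj]
        ext t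
        simp
        ring
    set r' := r - ∑ i, inner ℂ (e i) r • e i with hr'
    have hr0 : r' ≠ 0 := by
      intro h0
      apply hr
      rw [sub_eq_zero] at h0
      rw [h0]
      exact Submodule.sum_mem _ fun i _ => Submodule.smul_mem _ _ (Submodule.subset_span ⟨i, rfl⟩)
    have horth : ∀ i, inner ℂ (e i) r' = 0 := by
      intro i
      rw [hr', inner_sub_right, he.inner_right_fintype, sub_self]
    refine ⟨Fin.snoc e (((‖r'‖ : ℂ)⁻¹) • r'), ?_, ?_⟩
    · constructor
      · intro i
        refine Fin.lastCases ?_ (fun i => ?_) i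
        · simp [norm_smul, hr0]
        · simpa using he.1 i
      · intro i j
        refine Fin.lastCases ?_ (fun i => ?_) i <;> refine Fin.lastCases ?_ (fun j => ?_) j
        · simp
        · intro _
          have := horth j
          rw [inner_eq_zero_symm] at this
          simp [inner_smul_left, this]
        · intro _
          simp [inner_smul_right, horth]
        · intro hij
          simp
          exact he.2 (by rintro rfl; exact hij rfl)
    · intro i
      refine Fin.lastCases ?_ (fun i => ?_) i
      · rw [Fin.snoc_last]
        exact SS_smul (hres Finset.univ) _
      · rw [Fin.snoc_castSucc]
        exact heS i

lemma ONB_complete {k : ℕ} {f : Fin k → Fin k → ℂ} (hf : ONB f) :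
    ∑ i, vecMulVec (f i) (star (f i)) = 1 := by
  let F : Matrix (Fin k) (Fin k) ℂ := Matrix.of fun s i => f i s
  have h1 : Fᴴ * F = 1 := by
    ext i j
    simpa [Matrix.mul_apply, Matrix.one_apply, F] using hf i j
  rw [mul_eq_one_comm] at h1
  rw [← h1]
  ext s t
  simp [Matrix.mul_apply, F, Matrix.sum_apply, vecMulVec]

lemma memUA_of_span {n k : ℕ} [NeZero n] {U : Matrix (Fin n × Fin k) (Fin n × Fin k) ℂ}
    (hU : IsUnitary U)
    (hspan : Submodule.span ℂ {r : EuclideanSpace ℂ (Fin k) | SS U r.ofLp} = ⊤) : memUA U := by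
  obtain ⟨f, hf, hfS⟩ := exists_orthonormal hU hspan k le_rfl
  choose V c hV h using hfS
  have hf' : ∀ i j, star (f i).ofLp ⬝ᵥ (f j).ofLp = if i = j then (1 : ℂ) else 0 := by
    intro i j
    rw [← orthonormal_iff_ite.1 hf i j, EuclideanSpace.inner_eq_star_dotProduct, dotProduct_comm]
  have hfO : ONB (fun i => (f i).ofLp) := hf'
  refine ⟨V, c, fun i => (f i).ofLp, hV, ?_, hfO, ?_⟩
  · intro i j
    have hg := gram hU (h i) (h j)
    rw [hf'] at hg
    change star (c i) ⬝ᵥ c j = _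
    by_cases hij : i = j
    · subst hij
      rw [(hV i).2] at hg
      have := congrFun (congrFun hg 0) 0
      simpa using this.symm
    · simp only [hij, if_false, zero_smul] at hg ⊢
      have h2 := congrArg (fun M => V i * M * (V j)ᴴ) hg
      simp only [Matrix.mul_smul, Matrix.smul_mul, Matrix.mul_zero, Matrix.zero_mul,
        ← Matrix.mul_assoc, (hV i).1, Matrix.one_mul, (hV j).1] at h2
      have := congrFun (congrFun h2 0) 0
      simpa using this.symm
  · have h1 : (1 : Matrix (Fin n × Fin k) (Fin n × Fin k) ℂ) =
        ∑ i, DD (n := n) 1 (f i).ofLp * (DD (n := n) 1 (f i).ofLp)ᴴ := by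
      simp only [DD_mul_conj]
      have hc := ONB_complete hfO
      ext ⟨a, s⟩ ⟨b, t⟩
      have h3 := congrFun (congrFun hc s) t
      simp only [Matrix.sum_apply, kroneckerMap_apply] at h3 ⊢
      rw [← Finset.mul_sum, h3]
      simp only [Matrix.one_apply, Prod.mk.injEq]
      grind
    calc U = U * 1 := by simp
      _ = _ := by
        rw [h1, Finset.mul_sum]
        refine Finset.sum_congr rfl fun i _ => ?_
        rw [← Matrix.mul_assoc, h, DD_mul_conj]

lemma eq_of_density {k : ℕ} {M : Type*} [AddCommGroup M] [Module ℂ M]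
    (f g : Matrix (Fin k) (Fin k) ℂ →ₗ[ℂ] M) (h : ∀ β, IsDensity β → f β = g β) : f = g := by
  have hv : ∀ v : Fin k → ℂ, f (vecMulVec v (star v)) = g (vecMulVec v (star v)) := by
    intro v
    by_cases h0 : v = 0
    · simp [h0]
    have hp := posSemidef_vecMulVec_self_star v
    have ht : 0 < (vecMulVec v (star v)).trace := by
      rw [trace_vecMulVec]
      simpa [dotProduct_comm] using (dotProduct_star_self_pos_iff (v := v)).2 h0
    have hd : IsDensity ((vecMulVec v (star v)).trace⁻¹ • vecMulVec v (star v)) := by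
      refine ⟨hp.smul (inv_nonneg.2 ht.le), ?_⟩
      rw [trace_smul, smul_eq_mul, inv_mul_cancel₀ ht.ne']
    have := h _ hd
    rw [map_smul, map_smul] at this
    exact smul_right_injective _ (inv_ne_zero ht.ne') this
  have hpol : ∀ v w : Fin k → ℂ, f (vecMulVec v (star w)) = g (vecMulVec v (star w)) := by
    intro v w
    have e : vecMulVec v (star w) = (1/4 : ℂ) • (vecMulVec (v + w) (star (v + w))
        - vecMulVec (v - w) (star (v - w))
        + Complex.I • vecMulVec (v + Complex.I • w) (star (v + Complex.I • w))
        - Complex.I • vecMulVec (v - Complex.I • w) (star (v - Complex.I • w))) := by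
      ext s t
      simp [vecMulVec]
      ring_nf
      simp
      ring
    rw [e]
    simp only [map_smul, map_add, map_sub, hv]
  refine LinearMap.ext fun β => ?_
  rw [matrix_eq_sum_single β]
  simp only [map_sum]
  refine Finset.sum_congr rfl fun s _ => Finset.sum_congr rfl fun t _ => ?_
  have : Matrix.single s t (β s t) =
      vecMulVec (Pi.single s (β s t)) (star (Pi.single t (1:ℂ))) := by
    ext a b
    simp [Matrix.single_apply, vecMulVec, Pi.single_apply]
    grind
  rw [this, hpol]

lemma phi_vec {k : ℕ} (φ : Matrix (Fin k) (Fin k) ℂ →ₗ[ℂ] ℂ) (v : Fin k → ℂ) :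
    star v ⬝ᵥ ((Matrix.of fun t t' => φ (Matrix.single t t' 1)) *ᵥ v) =
      φ (vecMulVec (star v) v) := by
  conv_rhs => rw [matrix_eq_sum_single (vecMulVec (star v) v)]
  simp only [map_sum, dotProduct, mulVec, Finset.mul_sum, of_apply]
  refine Finset.sum_congr rfl fun s _ => Finset.sum_congr rfl fun t _ => ?_
  have : Matrix.single s t (vecMulVec (star v) v s t) =
      (star v s * v t) • Matrix.single s t (1 : ℂ) := by
    simp [vecMulVec]
  rw [this, map_smul, smul_eq_mul]
  ring

lemma phi_psd {k : ℕ} (φ : Matrix (Fin k) (Fin k) ℂ →ₗ[ℂ] ℂ)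
    (h : ∀ β, IsDensity β → (φ β).im = 0 ∧ 0 ≤ (φ β).re) :
    (Matrix.of fun t t' => φ (Matrix.single t t' 1)).PosSemidef := by
  have hpos : ∀ v : Fin k → ℂ, 0 ≤ φ (vecMulVec (star v) v) := by
    intro v
    by_cases h0 : v = 0
    · simp [h0]
    have hp : (vecMulVec (star v) v).PosSemidef := posSemidef_vecMulVec_star_self v
    have ht : 0 < (vecMulVec (star v) v).trace := by
      rw [trace_vecMulVec]
      exact dotProduct_star_self_pos_iff.2 h0
    have hd : IsDensity ((vecMulVec (star v) v).trace⁻¹ • vecMulVec (star v) v) := by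
      refine ⟨hp.smul (inv_nonneg.2 ht.le), ?_⟩
      rw [trace_smul, smul_eq_mul, inv_mul_cancel₀ ht.ne']
    have h1 := h _ hd
    have h2 : 0 ≤ φ ((vecMulVec (star v) v).trace⁻¹ • vecMulVec (star v) v) :=
      Complex.nonneg_iff.2 ⟨h1.2, h1.1.symm⟩
    have h3 := mul_nonneg ht.le h2
    rwa [map_smul, smul_eq_mul, mul_inv_cancel_left₀ ht.ne'] at h3
  have hherm : (Matrix.of fun t t' => φ (Matrix.single t t' 1)).IsHermitian := by
    let g : Matrix (Fin k) (Fin k) ℂ →ₗ[ℂ] ℂ :=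
      { toFun := fun β => star (φ βᴴ)
        map_add' := by intro x y; simp
        map_smul' := by intro c x; simp }
    have hg : g = φ := by
      apply eq_of_density
      intro β hβ
      change star (φ βᴴ) = φ β
      rw [hβ.1.1.eq]
      exact Complex.conj_eq_iff_im.2 (h β hβ).1
    ext t t'
    have h1 := LinearMap.congr_fun hg (Matrix.single t t' 1)
    change star (φ (Matrix.single t t' 1)ᴴ) = _ at h1
    rw [conjTranspose_single, star_one] at h1
    exact h1
  refine PosSemidef.of_dotProduct_mulVec_nonneg hherm fun v => ?_
  rw [phi_vec]
  exact hpos v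

lemma channel_single {n k : ℕ} (U : Matrix (Fin n × Fin k) (Fin n × Fin k) ℂ)
    (b b' a a' : Fin n) (t t' : Fin k) :
    channel U (Matrix.single t t' 1) (Matrix.single b b' 1) a a' =
      ∑ s, U (a, s) (b, t) * star (U (a', s) (b', t')) := by
  have : (Matrix.single b b' (1:ℂ)) ⊗ₖ (Matrix.single t t' (1:ℂ)) =
    Matrix.single (b, t) (b', t') 1 := by
    ext ⟨x, y⟩ ⟨x', y'⟩
    simp only [kroneckerMap_apply, Matrix.single_apply, Prod.mk.injEq]
    grind
  simp only [channel, trB, this]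
  refine Finset.sum_congr rfl fun s _ => ?_
  simp [Matrix.mul_apply, Matrix.single_apply, Finset.sum_ite_eq, ite_and]

/-- The channel as a linear map in `β`. -/
def chanLin {n k : ℕ} (U : Matrix (Fin n × Fin k) (Fin n × Fin k) ℂ)
    (X : Matrix (Fin n) (Fin n) ℂ) :
    Matrix (Fin k) (Fin k) ℂ →ₗ[ℂ] Matrix (Fin n) (Fin n) ℂ where
  toFun β := channel U β X
  map_add' x y := by
    ext a a'
    simp [channel, trB, kronecker_add, Matrix.mul_add, Matrix.add_mul, Finset.sum_add_distrib]
  map_smul' c x := by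
    ext a a'
    simp [channel, trB, kronecker_smul, Finset.mul_sum]

lemma span_of_prob {n k r : ℕ} {U : Matrix (Fin n × Fin k) (Fin n × Fin k) ℂ}
    (hU : IsUnitary U) (Us : Fin r → Matrix (Fin n) (Fin n) ℂ)
    (φ : Fin r → Matrix (Fin k) (Fin k) ℂ →ₗ[ℂ] ℂ)
    (hUs : ∀ i, IsUnitary (Us i))
    (hφ : ∀ β : Matrix (Fin k) (Fin k) ℂ, IsDensity β →
          (∀ i, (φ i β).im = 0 ∧ 0 ≤ (φ i β).re) ∧ (∑ i, φ i β) = 1)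
    (hch : ∀ β : Matrix (Fin k) (Fin k) ℂ, IsDensity β →
          ∀ X : Matrix (Fin n) (Fin n) ℂ,
            channel U β X = ∑ i, φ i β • (Us i * X * (Us i)ᴴ)) :
    Submodule.span ℂ {r : EuclideanSpace ℂ (Fin k) | SS U r.ofLp} = ⊤ := by
  set Q : Fin r → Matrix (Fin k) (Fin k) ℂ :=
    fun i => Matrix.of fun t t' => φ i (Matrix.single t t' 1) with hQ
  have hpsd : ∀ i, (Q i).PosSemidef := fun i => phi_psd (φ i) fun β hβ => (hφ β hβ).1 i
  have hsum : ∑ i, Q i = 1 := by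
    have h1 : ∑ i, φ i = Matrix.traceLinearMap (Fin k) ℂ ℂ := by
      apply eq_of_density
      intro β hβ
      simp [(hφ β hβ).2, hβ.2]
    ext t t'
    have h2 := LinearMap.congr_fun h1 (Matrix.single t t' 1)
    simp only [LinearMap.sum_apply, traceLinearMap_apply] at h2
    simp only [Matrix.sum_apply, hQ, of_apply, h2, Matrix.one_apply]
    by_cases htt : t = t'
    · subst htt; simp
    · simp [htt]
  have key : ∀ a a' b b' t t', ∑ s, U (a, s) (b, t) * star (U (a', s) (b', t')) =
      ∑ i, Q i t t' * (Us i a b * star (Us i a' b')) := by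
    intro a a' b b' t t'
    have h1 : chanLin U (Matrix.single b b' 1) =
        ∑ i, (φ i).smulRight (Us i * Matrix.single b b' 1 * (Us i)ᴴ) := by
      apply eq_of_density
      intro β hβ
      simpa [chanLin] using hch β hβ _
    have h2 := LinearMap.congr_fun h1 (Matrix.single t t' 1)
    have h3 := congrFun (congrFun h2 a) a'
    rw [← channel_single]
    refine h3.trans ?_
    simp only [LinearMap.sum_apply, LinearMap.smulRight_apply, Matrix.sum_apply, Matrix.smul_apply,
      smul_eq_mul]
    refine Finset.sum_congr rfl fun i _ => ?_
    simp [hQ, Matrix.mul_apply, Matrix.single_apply, Finset.sum_ite_eq, ite_and]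
  have hSS : ∀ i t, SS U (fun t' => Q i t t') := by
    intro i t
    let κ : Fin k → EuclideanSpace ℂ (Fin k × Fin n × Fin n) :=
      fun s => WithLp.toLp 2 fun j => U (j.2.1, s) (j.2.2, j.1)
    let Z : EuclideanSpace ℂ (Fin k × Fin n × Fin n) :=
      WithLp.toLp 2 fun j => Us i j.2.1 j.2.2 * Q i j.1 t
    have hZ : Z ∈ Submodule.span ℂ (Set.range κ) := by
      rw [← Submodule.orthogonal_orthogonal (Submodule.span ℂ (Set.range κ))]
      rw [Submodule.mem_orthogonal']
      intro T hT
      rw [Submodule.mem_orthogonal'] at hT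
      have hT' : ∀ s, inner ℂ T (κ s) = 0 := fun s => hT _ (Submodule.subset_span ⟨s, rfl⟩)
      let w : Fin r → Fin k → ℂ := fun i t => ∑ p : Fin n × Fin n, star (Us i p.1 p.2) * T (t, p)
      have hq : ∑ s, inner ℂ T (κ s) * star (inner ℂ T (κ s)) =
          ∑ i, star (w i) ⬝ᵥ (Q i *ᵥ w i) := by
        have hl : ∀ s, inner ℂ T (κ s) * star (inner ℂ T (κ s)) =
            ∑ j, ∑ j', star (T j) * T j' *
              (U (j.2.1, s) (j.2.2, j.1) * star (U (j'.2.1, s) (j'.2.2, j'.1))) := by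
          intro s
          rw [EuclideanSpace.inner_eq_star_dotProduct]
          simp only [dotProduct, star_sum, Finset.sum_mul_sum]
          refine Finset.sum_congr rfl fun j _ => Finset.sum_congr rfl fun j' _ => ?_
          simp only [κ, Pi.star_apply, star_mul', star_star]
          ring
        have hr : ∀ i, star (w i) ⬝ᵥ (Q i *ᵥ w i) =
            ∑ j, ∑ j', star (T j) * T j' *
              (Q i j.1 j'.1 * (Us i j.2.1 j.2.2 * star (Us i j'.2.1 j'.2.2))) := by
          intro i
          rw [Fintype.sum_prod_type]
          simp only [dotProduct, mulVec]
          refine Finset.sum_congr rfl fun t _ => ?_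
          simp only [w, Pi.star_apply, star_sum]
          rw [Finset.sum_mul]
          refine Finset.sum_congr rfl fun p _ => ?_
          rw [Fintype.sum_prod_type, Finset.mul_sum]
          refine Finset.sum_congr rfl fun t' _ => ?_
          rw [Finset.mul_sum, Finset.mul_sum]
          refine Finset.sum_congr rfl fun p' _ => ?_
          simp only [star_mul', star_star]
          ring
        simp only [hl, hr]
        rw [Finset.sum_comm]
        conv_rhs => rw [Finset.sum_comm]
        refine Finset.sum_congr rfl fun j _ => ?_
        rw [Finset.sum_comm]
        conv_rhs => rw [Finset.sum_comm]
        refine Finset.sum_congr rfl fun j' _ => ?_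
        rw [← Finset.mul_sum, ← Finset.mul_sum, key]
      have hq0 : ∑ i, star (w i) ⬝ᵥ (Q i *ᵥ w i) = 0 := by
        rw [← hq]
        simp [hT']
      have hqi := (Finset.sum_eq_zero_iff_of_nonneg
        (fun i _ => (hpsd i).dotProduct_mulVec_nonneg (w i))).1 hq0 i (Finset.mem_univ i)
      rw [(hpsd i).dotProduct_mulVec_zero_iff] at hqi
      have h4 := congrFun hqi t
      simp only [mulVec, dotProduct, Pi.zero_apply] at h4
      rw [← h4, EuclideanSpace.inner_eq_star_dotProduct]
      simp only [dotProduct]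
      rw [Fintype.sum_prod_type]
      refine Finset.sum_congr rfl fun t' _ => ?_
      simp only [w, Finset.mul_sum]
      refine Finset.sum_congr rfl fun p _ => ?_
      simp only [Z, Pi.star_apply, star_mul']
      rw [(hpsd i).1.apply t t']
      ring
    obtain ⟨c, hc⟩ := (Submodule.mem_span_range_iff_exists_fun ℂ).1 hZ
    have hc' : ∀ a b t', ∑ s, c s * U (a, s) (b, t') = Us i a b * Q i t' t := by
      intro a b t'
      have := congrArg (fun x => x.ofLp (t', a, b)) hc
      simpa [κ, Z] using this
    refine ⟨Us i, star c, hUs i, ?_⟩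
    have h6 : Uᴴ * DD (n := n) 1 (star c) = DD (Us i)ᴴ (fun t' => Q i t t') := by
      ext ⟨b, t'⟩ a
      rw [U_DD_apply]
      have := congrArg star (hc' a b t')
      rw [star_mul', (hpsd i).1.apply t t', star_sum] at this
      simp only [DD, conjTranspose_apply]
      rw [← this]
      refine Finset.sum_congr rfl fun s _ => ?_
      rw [star_mul', Pi.star_apply, mul_comm]
    have h7 : DD (n := n) 1 (fun t' => Q i t t') = Uᴴ * DD (n := n) 1 (star c) * Us i := by
      rw [h6, DD_mul_right, (hUs i).2]
    rw [h7, ← Matrix.mul_assoc, ← Matrix.mul_assoc, hU.1, Matrix.one_mul, DD_mul_right,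
      Matrix.one_mul]
  rw [eq_top_iff]
  rintro x -
  have hx : x = ∑ t, x t • ∑ i, (WithLp.toLp 2 fun t' => Q i t t' : EuclideanSpace ℂ (Fin k)) := by
    ext t'
    have h5 : ∀ t, ∑ i, Q i t t' = (1 : Matrix (Fin k) (Fin k) ℂ) t t' := by
      intro t
      rw [← hsum, Matrix.sum_apply]
    simp [h5, Matrix.one_apply]
  rw [hx]
  exact Submodule.sum_mem _ fun t _ => Submodule.smul_mem _ _ <|
    Submodule.sum_mem _ fun i _ => Submodule.subset_span (hSS i t)

lemma prob_of_memUA {n k : ℕ} {U : Matrix (Fin n × Fin k) (Fin n × Fin k) ℂ} (h : memUA U) :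
    (∃ (r : ℕ) (Us : Fin r → Matrix (Fin n) (Fin n) ℂ)
        (φ : Fin r → Matrix (Fin k) (Fin k) ℂ →ₗ[ℂ] ℂ),
        (∀ i, IsUnitary (Us i)) ∧
        (∀ β : Matrix (Fin k) (Fin k) ℂ, IsDensity β →
          (∀ i, (φ i β).im = 0 ∧ 0 ≤ (φ i β).re) ∧ (∑ i, φ i β) = 1) ∧
        (∀ β : Matrix (Fin k) (Fin k) ℂ, IsDensity β →
          ∀ X : Matrix (Fin n) (Fin n) ℂ,
            channel U β X = ∑ i, φ i β • (Us i * X * (Us i)ᴴ))) := by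
  obtain ⟨V, e, f, hV, he, hf, rfl⟩ := h
  refine ⟨k, V, fun i => (Matrix.traceLinearMap (Fin k) ℂ ℂ).comp
    (LinearMap.mulRight ℂ (vecMulVec (f i) (star (f i)))), hV, ?_, ?_⟩
  · intro β hβ
    have hφ : ∀ i, (β * vecMulVec (f i) (star (f i))).trace = star (f i) ⬝ᵥ (β *ᵥ f i) := by
      intro i
      rw [mul_vecMulVec, trace_vecMulVec, dotProduct_comm]
    constructor
    · intro i
      have := hβ.1.dotProduct_mulVec_nonneg (f i)
      rw [Complex.nonneg_iff] at this
      simp only [LinearMap.comp_apply, LinearMap.mulRight_apply, traceLinearMap_apply, hφ]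
      exact ⟨this.2.symm, this.1⟩
    · simp only [LinearMap.comp_apply, LinearMap.mulRight_apply, traceLinearMap_apply]
      rw [← trace_sum, ← Finset.mul_sum, ONB_complete hf, Matrix.mul_one, hβ.2]
  · intro β _ X
    have htr : ∀ i j, (vecMulVec (e i) (star (f i)) * β * (vecMulVec (e j) (star (f j)))ᴴ).trace =
        if i = j then (β * vecMulVec (f i) (star (f i))).trace else 0 := by
      intro i j
      have h1 : (vecMulVec (e j) (star (f j)))ᴴ * vecMulVec (e i) (star (f i)) =
          (star (e j) ⬝ᵥ e i) • vecMulVec (f j) (star (f i)) := by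
        rw [conjTranspose_vecMulVec, star_star, vecMulVec_mul_vecMulVec, vecMulVec_smul]
      have h2 : star (e j) ⬝ᵥ e i = if j = i then 1 else 0 := he j i
      rw [Matrix.trace_mul_comm, ← Matrix.mul_assoc, h1, Matrix.trace_mul_comm, h2]
      by_cases hij : i = j
      · subst hij; simp
      · simp [hij, Ne.symm hij]
    have htb : ∀ (A : Matrix (Fin n) (Fin n) ℂ) (B : Matrix (Fin k) (Fin k) ℂ),
        trB (A ⊗ₖ B) = B.trace • A := by
      intro A B
      ext a a'
      simp [trB, Matrix.trace, Finset.mul_sum, mul_comm]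
    have hsumB : ∀ (g : Fin k → Fin k → Matrix (Fin n × Fin k) (Fin n × Fin k) ℂ),
        trB (∑ i, ∑ j, g i j) = ∑ i, ∑ j, trB (g i j) := by
      intro g
      ext a a'
      simp only [trB, Matrix.sum_apply]
      rw [Finset.sum_comm]
      refine Finset.sum_congr rfl fun i _ => ?_
      rw [Finset.sum_comm]
    have hprod : (∑ i, V i ⊗ₖ vecMulVec (e i) (star (f i))) * (X ⊗ₖ β) *
        (∑ i, V i ⊗ₖ vecMulVec (e i) (star (f i)))ᴴ = ∑ i, ∑ j, (V i * X * (V j)ᴴ) ⊗ₖ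
          (vecMulVec (e i) (star (f i)) * β * (vecMulVec (e j) (star (f j)))ᴴ) := by
      rw [conjTranspose_sum, Finset.sum_mul, Finset.sum_mul_sum]
      simp only [conjTranspose_kronecker, ← mul_kronecker_mul]
    rw [channel, hprod, hsumB]
    simp only [htb, htr]
    simp

theorem stmt17 (n k : ℕ)
    (U : Matrix (Fin n × Fin k) (Fin n × Fin k) ℂ) (hU : IsUnitary U) :
    (∃ (r : ℕ) (Us : Fin r → Matrix (Fin n) (Fin n) ℂ)
        (φ : Fin r → Matrix (Fin k) (Fin k) ℂ →ₗ[ℂ] ℂ),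
        (∀ i, IsUnitary (Us i)) ∧
        (∀ β : Matrix (Fin k) (Fin k) ℂ, IsDensity β →
          (∀ i, (φ i β).im = 0 ∧ 0 ≤ (φ i β).re) ∧ (∑ i, φ i β) = 1) ∧
        (∀ β : Matrix (Fin k) (Fin k) ℂ, IsDensity β →
          ∀ X : Matrix (Fin n) (Fin n) ℂ,
            channel U β X = ∑ i, φ i β • (Us i * X * (Us i)ᴴ)))
    ↔ memUA U := by
  constructor
  · rintro ⟨r, Us, φ, hUs, hφ, hch⟩
    rcases Nat.eq_zero_or_pos n with rfl | hn
    · have h1 : ONB (fun i : Fin k => (Pi.single i 1 : Fin k → ℂ)) := by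
        intro i j
        simp [Pi.single_apply, eq_comm]
      refine ⟨fun _ => 1, _, _, fun _ => by simp [IsUnitary], h1, h1, ?_⟩
      ext p
      exact p.1.elim0
    · have : NeZero n := ⟨hn.ne'⟩
      exact memUA_of_span hU (span_of_prob hU Us φ hUs hφ hch)
  · exact prob_of_memUA

end BipartiteUnitary
end
end
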